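/- Let p₀ be any exponent with 1 < p₀ < ∞. Then the union over p > 1 of the weak Lebesgue spaces L^{p,∞}(ℝ^n) is properly contained in the union over w ∈ A_{p₀}(ℝ^n) of L^{p₀}_w(ℝ^n), which in turn is properly contained in 𝓜_{A₁}(ℝ^n). (Both containments are strict.) -/

import Mathlib

open MeasureTheory ENNReal

/-- A (nondegenerate) cube in `ℝⁿ` with sides parallel to the axes. -/
def IsCube {n : ℕ} (Q : Set (Fin n → ℝ)) : Prop :=
  ∃ (a : Fin n → ℝ) (l : ℝ), 0 < l ∧
    Q = Set.univ.pi fun i => Set.Icc (a i) (a i + l)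

/-- The domains considered: all of `ℝⁿ` or a cube with sides parallel to the axes. -/
def IsAdmissibleDomain {n : ℕ} (Ω : Set (Fin n → ℝ)) : Prop :=
  Ω = Set.univ ∨ IsCube Ω

/-- The Hardy–Littlewood maximal operator restricted to `Ω`:
`M_Ω f (x) = sup { (1/|Q|) ∫_Q |f| : Q ⊆ Ω a cube with x ∈ Q }`. -/
noncomputable def maximal {n : ℕ} (Ω : Set (Fin n → ℝ)) (f : (Fin n → ℝ) → ℝ)
    (x : Fin n → ℝ) : ℝ≥0∞ :=
  ⨆ (Q : Set (Fin n → ℝ)) (_ : IsCube Q) (_ : Q ⊆ Ω) (_ : x ∈ Q),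
    (volume Q)⁻¹ * ∫⁻ y in Q, ENNReal.ofReal |f y|

/-- A weight on `Ω`: a measurable function, positive a.e. on `Ω`, integrable on every
cube contained in `Ω` (hence locally integrable; integrable when `Ω` is itself a cube). -/
structure IsWeight {n : ℕ} (Ω : Set (Fin n → ℝ)) (w : (Fin n → ℝ) → ℝ) : Prop where
  measurable : Measurable w
  pos : ∀ᵐ x ∂(volume.restrict Ω), 0 < w x
  locInt : ∀ Q : Set (Fin n → ℝ), IsCube Q → Q ⊆ Ω → IntegrableOn w Q

/-- The Muckenhoupt `A₁(Ω)` class: `M_Ω w ≤ C w` a.e. on `Ω`. -/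
def MemA1 {n : ℕ} (Ω : Set (Fin n → ℝ)) (w : (Fin n → ℝ) → ℝ) : Prop :=
  IsWeight Ω w ∧ ∃ C : ℝ, ∀ᵐ x ∂(volume.restrict Ω),
    maximal Ω w x ≤ ENNReal.ofReal (C * w x)

/-- The Muckenhoupt `A_p(Ω)` class for `1 < p < ∞`:
`sup_{Q ⊆ Ω} (avg_Q w) * (avg_Q w^(1-p'))^(p-1) < ∞` where `p' = p/(p-1)`. -/
def MemApGT1 {n : ℕ} (Ω : Set (Fin n → ℝ)) (p : ℝ) (w : (Fin n → ℝ) → ℝ) : Prop :=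
  IsWeight Ω w ∧ ∃ C : ℝ≥0∞, C ≠ ∞ ∧ ∀ Q : Set (Fin n → ℝ), IsCube Q → Q ⊆ Ω →
    ((volume Q)⁻¹ * ∫⁻ x in Q, ENNReal.ofReal (w x)) *
      ((volume Q)⁻¹ * ∫⁻ x in Q, ENNReal.ofReal (w x ^ (1 - p / (p - 1)))) ^ (p - 1) ≤ C

/-- The Muckenhoupt `A_p(Ω)` class for `1 ≤ p < ∞`. -/
def MemA {n : ℕ} (Ω : Set (Fin n → ℝ)) (p : ℝ) (w : (Fin n → ℝ) → ℝ) : Prop :=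
  (p = 1 ∧ MemA1 Ω w) ∨ (1 < p ∧ MemApGT1 Ω p w)

/-- The Muckenhoupt `A_∞(Ω)` class: the union of `A_p(Ω)` over `1 ≤ p < ∞`. -/
def MemAInf {n : ℕ} (Ω : Set (Fin n → ℝ)) (w : (Fin n → ℝ) → ℝ) : Prop :=
  ∃ p : ℝ, 1 ≤ p ∧ MemA Ω p w

/-- Membership in the weighted Lebesgue space `L^p_w(Ω)`: `f` measurable with
`∫_Ω |f|^p w < ∞`. -/
def MemLw {n : ℕ} (Ω : Set (Fin n → ℝ)) (p : ℝ) (w f : (Fin n → ℝ) → ℝ) : Prop :=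
  Measurable f ∧
    ∫⁻ x in Ω, ENNReal.ofReal |f x| ^ p * ENNReal.ofReal (w x) < ⊤

/-- Membership in the (unweighted) Lebesgue space `L^p(Ω)`. -/
def MemLeb {n : ℕ} (Ω : Set (Fin n → ℝ)) (p : ℝ) (f : (Fin n → ℝ) → ℝ) : Prop :=
  MemLw Ω p (fun _ => 1) f

/-- `f ∈ 𝓜_{A_p}(Ω)`: `f` is measurable and `|f| ≤ w` a.e. on `Ω` for some `w ∈ A_p(Ω)`. -/
def HasApMajorant {n : ℕ} (Ω : Set (Fin n → ℝ)) (p : ℝ) (f : (Fin n → ℝ) → ℝ) : Prop :=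
  Measurable f ∧ ∃ w, MemA Ω p w ∧ ∀ᵐ x ∂(volume.restrict Ω), |f x| ≤ w x

/-- `f ∈ 𝓜^r_{A_p}(Ω)`: `f` is measurable and `|f|^r ≤ w` a.e. on `Ω` for some
`w ∈ A_p(Ω)`. -/
def HasApPowMajorant {n : ℕ} (Ω : Set (Fin n → ℝ)) (p r : ℝ) (f : (Fin n → ℝ) → ℝ) : Prop :=
  Measurable f ∧ ∃ w, MemA Ω p w ∧ ∀ᵐ x ∂(volume.restrict Ω), |f x| ^ r ≤ w x

/-- `f ∈ 𝓜_{A_∞}(Ω)`: `f` is measurable and `|f| ≤ w` a.e. on `Ω` for some `w ∈ A_∞(Ω)`. -/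
def HasAInfMajorant {n : ℕ} (Ω : Set (Fin n → ℝ)) (f : (Fin n → ℝ) → ℝ) : Prop :=
  Measurable f ∧ ∃ w, MemAInf Ω w ∧ ∀ᵐ x ∂(volume.restrict Ω), |f x| ≤ w x

/-- Membership in weak `L^p(ℝⁿ)`: `sup_{t>0} t · |{|f| > t}|^{1/p} < ∞`. -/
def MemWeakLp {n : ℕ} (p : ℝ) (f : (Fin n → ℝ) → ℝ) : Prop :=
  Measurable f ∧ ∃ C : ℝ≥0∞, C ≠ ⊤ ∧ ∀ t : ℝ, 0 < t →
    ENNReal.ofReal t * volume {x | t < |f x|} ^ (1 / p) ≤ C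


open Metric Set Filter Topology

section BallMaximal

variable {X : Type*} [MetricSpace X] [MeasurableSpace X]

/-- The uncentered maximal function over open balls, with respect to a measure `μ`. -/
noncomputable def ballMaximal (μ : Measure X) (g : X → ℝ≥0∞) (x : X) : ℝ≥0∞ :=
  ⨆ (c : X) (r : ℝ) (_ : 0 < r),
    (ball c r).indicator (fun _ => (∫⁻ y in ball c r, g y ∂μ) / μ (ball c r)) x

theorem le_ballMaximal (μ : Measure X) (g : X → ℝ≥0∞) {x c : X} {r : ℝ} (hr : 0 < r)
    (hx : x ∈ ball c r) :
    (∫⁻ y in ball c r, g y ∂μ) / μ (ball c r) ≤ ballMaximal μ g x := by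
  refine le_trans (le_of_eq ?_) (le_iSup₂_of_le c r (le_iSup_of_le hr le_rfl))
  rw [indicator_of_mem hx]

theorem lt_ballMaximal_iff {μ : Measure X} {g : X → ℝ≥0∞} {x : X} {t : ℝ≥0∞} :
    t < ballMaximal μ g x ↔ ∃ c r, 0 < r ∧ x ∈ ball c r ∧
      t < (∫⁻ y in ball c r, g y ∂μ) / μ (ball c r) := by
  constructor
  · intro h
    simp only [ballMaximal, lt_iSup_iff] at h
    obtain ⟨c, r, hr, h⟩ := h
    by_cases hx : x ∈ ball c r
    · rw [indicator_of_mem hx] at h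
      exact ⟨c, r, hr, hx, h⟩
    · rw [indicator_of_notMem hx] at h
      exact absurd h ENNReal.not_lt_zero
  · rintro ⟨c, r, hr, hx, h⟩
    exact h.trans_le (le_ballMaximal μ g hr hx)

theorem ballMaximal_le_iff {μ : Measure X} {g : X → ℝ≥0∞} {x : X} {t : ℝ≥0∞} :
    ballMaximal μ g x ≤ t ↔ ∀ c r, 0 < r → x ∈ ball c r →
      (∫⁻ y in ball c r, g y ∂μ) / μ (ball c r) ≤ t := by
  rw [← not_lt, lt_ballMaximal_iff]
  push Not
  rfl

theorem measurable_ballMaximal [BorelSpace X] (μ : Measure X) (g : X → ℝ≥0∞) :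
    Measurable (ballMaximal μ g) := by
  refine LowerSemicontinuous.measurable ?_
  unfold ballMaximal
  exact lowerSemicontinuous_iSup fun c => lowerSemicontinuous_iSup fun r =>
    lowerSemicontinuous_iSup fun _ => isOpen_ball.lowerSemicontinuous_indicator zero_le

/-- Weak type (1,1) of the maximal operator of a doubling measure. -/
theorem mul_measure_lt_ballMaximal_le [TopologicalSpace.SeparableSpace X] [BorelSpace X]
    {μ : Measure X} {D : ℝ≥0∞}
    (hD : ∀ (c : X) (r : ℝ), 0 < r → μ (closedBall c (5 * r)) ≤ D * μ (ball c r))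
    (g : X → ℝ≥0∞) (t : ℝ≥0∞) :
    t * μ {x | t < ballMaximal μ g x} ≤ D * ∫⁻ x, g x ∂μ := by
  let F : ℕ → Set (X × ℝ) := fun R => {a | 0 < a.2 ∧ a.2 ≤ R ∧
    t < (∫⁻ y in ball a.1 a.2, g y ∂μ) / μ (ball a.1 a.2)}
  let S : ℕ → Set X := fun R => ⋃ a ∈ F R, ball a.1 a.2
  have hSmono : Monotone S := fun R R' h => biUnion_subset_biUnion_left fun a ha =>
    ⟨ha.1, ha.2.1.trans (Nat.cast_le.2 h), ha.2.2⟩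
  have hS : {x | t < ballMaximal μ g x} = ⋃ R, S R := by
    ext x
    simp only [mem_ofPred_eq, lt_ballMaximal_iff, mem_iUnion, S, F, Prod.exists, exists_prop]
    constructor
    · rintro ⟨c, r, hr, hx, h⟩
      obtain ⟨R, hR⟩ := exists_nat_ge r
      exact ⟨R, c, r, ⟨hr, hR, h⟩, hx⟩
    · rintro ⟨R, c, r, ⟨hr, hR, h⟩, hx⟩
      exact ⟨c, r, hr, hx, h⟩
  rw [hS, hSmono.measure_iUnion, ENNReal.mul_iSup]
  refine iSup_le fun R => ?_
  obtain ⟨u, huF, hudisj, hucov⟩ :=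
    Vitali.exists_disjoint_subfamily_covering_enlargement_closedBall (F R) Prod.fst Prod.snd R
      (fun a ha => ha.2.1) 5 (by norm_num)
  have hucount : u.Countable := hudisj.countable_of_nonempty_interior fun a ha =>
    ⟨a.1, mem_interior.2 ⟨_, ball_subset_closedBall, isOpen_ball, mem_ball_self (huF ha).1⟩⟩
  have hdisj : u.PairwiseDisjoint fun a => ball a.1 a.2 :=
    hudisj.mono fun a => ball_subset_closedBall
  have hcov : S R ⊆ ⋃ b ∈ u, closedBall b.1 (5 * b.2) := by
    refine iUnion₂_subset fun a ha => ?_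
    obtain ⟨b, hb, hab⟩ := hucov a ha
    exact (ball_subset_closedBall.trans hab).trans
      (subset_biUnion_of_mem (u := fun b : X × ℝ => closedBall b.1 (5 * b.2)) hb)
  calc t * μ (S R) ≤ t * ∑' b : u, D * μ (ball b.1.1 b.1.2) := by
        gcongr
        refine (measure_mono hcov).trans ((measure_biUnion_le μ hucount _).trans ?_)
        exact ENNReal.tsum_le_tsum fun b => hD _ _ (huF b.2).1
    _ = D * ∑' b : u, t * μ (ball b.1.1 b.1.2) := by
        simp only [ENNReal.tsum_mul_left]
        ring
    _ ≤ D * ∑' b : u, ∫⁻ y in ball b.1.1 b.1.2, g y ∂μ := by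
        gcongr with b
        exact ENNReal.mul_le_of_le_div (huF b.2).2.2.le
    _ = D * ∫⁻ y in ⋃ b ∈ u, ball b.1 b.2, g y ∂μ := by
        rw [lintegral_biUnion hucount (fun b _ => measurableSet_ball) hdisj]
    _ ≤ D * ∫⁻ y, g y ∂μ := by
        gcongr
        exact Measure.restrict_le_self

theorem lintegral_Ioo_rpow_sub_one {s b : ℝ} (hs : 0 < s) (hb : 0 ≤ b) :
    ∫⁻ t in Ioo 0 b, ENNReal.ofReal (t ^ (s - 1)) = ENNReal.ofReal (b ^ s / s) := by
  have hint : IntervalIntegrable (fun x : ℝ => x ^ (s - 1)) volume 0 b :=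
    intervalIntegral.intervalIntegrable_rpow' (by linarith)
  rw [← setLIntegral_congr (Ioo_ae_eq_Ioc (a := (0 : ℝ)) (b := b)).symm,
    ← ofReal_integral_eq_lintegral_ofReal
      ((intervalIntegrable_iff_integrableOn_Ioc_of_le hb).1 hint),
    ← intervalIntegral.integral_of_le hb, integral_rpow (Or.inl (by linarith)),
    sub_add_cancel, Real.zero_rpow hs.ne', sub_zero]
  filter_upwards [ae_restrict_mem measurableSet_Ioc] with x hx using Real.rpow_nonneg hx.1.le _

/-- The layer-cake formula for a single extended nonnegative number. -/
theorem lintegral_Ioi_indicator_rpow {s : ℝ} (hs : 0 < s) (y : ℝ≥0∞) :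
    ∫⁻ t in Ioi (0 : ℝ), {t : ℝ | ENNReal.ofReal t < y}.indicator
      (fun t => ENNReal.ofReal (t ^ (s - 1))) t = ENNReal.ofReal s⁻¹ * y ^ s := by
  have hm : MeasurableSet {t : ℝ | ENNReal.ofReal t < y} :=
    ENNReal.measurable_ofReal measurableSet_Iio
  have key : ∀ b : ℝ, 0 ≤ b →
      ∫⁻ t in Ioi (0 : ℝ), {t : ℝ | ENNReal.ofReal t < ENNReal.ofReal b}.indicator
      (fun t => ENNReal.ofReal (t ^ (s - 1))) t = ENNReal.ofReal s⁻¹ * (ENNReal.ofReal b) ^ s := by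
    intro b hb
    have hm : MeasurableSet {t : ℝ | ENNReal.ofReal t < ENNReal.ofReal b} :=
      ENNReal.measurable_ofReal measurableSet_Iio
    rw [setLIntegral_indicator hm]
    have : {t : ℝ | ENNReal.ofReal t < ENNReal.ofReal b} ∩ Ioi 0 = Ioo 0 b := by
      ext t
      simp only [mem_inter_iff, mem_ofPred_eq, mem_Ioi, mem_Ioo]
      constructor
      · rintro ⟨h1, h2⟩
        exact ⟨h2, (ENNReal.ofReal_lt_ofReal_iff_of_nonneg h2.le).1 h1⟩
      · rintro ⟨h1, h2⟩
        exact ⟨(ENNReal.ofReal_lt_ofReal_iff_of_nonneg h1.le).2 h2, h1⟩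
    rw [this, lintegral_Ioo_rpow_sub_one hs hb, ENNReal.ofReal_rpow_of_nonneg hb hs.le,
      ← ENNReal.ofReal_mul (by positivity), div_eq_inv_mul]
  by_cases hy : y = ∞
  · subst hy
    rw [ENNReal.top_rpow_of_pos hs, ENNReal.mul_top (by simpa using hs)]
    refine ENNReal.eq_top_of_forall_nnreal_le fun r => ?_
    have hb : (0 : ℝ) ≤ ((r : ℝ) * s) ^ s⁻¹ := by positivity
    have h1 := key _ hb
    rw [ENNReal.ofReal_rpow_of_nonneg hb hs.le, ← Real.rpow_mul (by positivity),
      inv_mul_cancel₀ hs.ne', Real.rpow_one, ← ENNReal.ofReal_mul (by positivity),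
      show s⁻¹ * ((r : ℝ) * s) = r by field_simp, ENNReal.ofReal_coe_nnreal] at h1
    rw [← h1]
    refine lintegral_mono fun t => indicator_le_indicator_of_subset ?_ (fun _ => zero_le) t
    exact fun t _ => ENNReal.ofReal_lt_top
  · have := key y.toReal ENNReal.toReal_nonneg
    rwa [ENNReal.ofReal_toReal hy] at this

theorem ballMaximal_le_add (μ : Measure X) (g : X → ℝ≥0∞) (t : ℝ≥0∞) (x : X) :
    ballMaximal μ g x ≤ ballMaximal μ ({y | t < g y}.indicator g) x + t := by
  refine ballMaximal_le_iff.2 fun c r hr hx => ?_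
  refine le_trans ?_ (add_le_add_left (le_ballMaximal μ _ hr hx) t)
  have h1 : ∫⁻ y in ball c r, g y ∂μ ≤
      (∫⁻ y in ball c r, {y | t < g y}.indicator g y ∂μ) + t * μ (ball c r) := by
    rw [← setLIntegral_const, ← lintegral_add_right _ measurable_const]
    refine lintegral_mono fun y => ?_
    by_cases h : t < g y
    · rw [indicator_of_mem (by exact h)]
      exact le_self_add
    · exact (not_lt.1 h).trans le_add_self
  calc _ ≤ _ := ENNReal.div_le_div_right h1 _
    _ = _ := ENNReal.add_div
    _ ≤ _ := by
      gcongr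
      exact ENNReal.div_le_of_le_mul le_rfl

/-- Strong type (p,p) of the maximal operator of a doubling measure. -/
theorem exists_lintegral_ballMaximal_rpow_le [TopologicalSpace.SeparableSpace X] [BorelSpace X]
    {μ : Measure X} [SFinite μ] {D : ℝ≥0∞} (hDtop : D ≠ ∞)
    (hD : ∀ (c : X) (r : ℝ), 0 < r → μ (closedBall c (5 * r)) ≤ D * μ (ball c r))
    {p : ℝ} (hp : 1 < p) :
    ∃ A : ℝ≥0∞, A ≠ ∞ ∧ ∀ g : X → ℝ≥0∞, Measurable g →
      ∫⁻ x, ballMaximal μ g x ^ p ∂μ ≤ A * ∫⁻ x, g x ^ p ∂μ := by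
  have hp0 : 0 < p := by linarith
  refine ⟨ENNReal.ofReal p * (2 * D * (ENNReal.ofReal (p - 1)⁻¹ * 2 ^ (p - 1))),
    by finiteness, fun g hg => ?_⟩
  have hM := measurable_ballMaximal μ g
  have hswap : ∀ (s : ℝ) (h : X → ℝ≥0∞) (k : X → ℝ≥0∞), Measurable h → Measurable k →
      ∫⁻ x, k x * (∫⁻ t in Ioi (0 : ℝ), {t : ℝ | ENNReal.ofReal t < h x}.indicator
        (fun t => ENNReal.ofReal (t ^ (s - 1))) t) ∂μ =
      ∫⁻ t in Ioi (0 : ℝ), ENNReal.ofReal (t ^ (s - 1)) *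
        ∫⁻ x, {x | ENNReal.ofReal t < h x}.indicator k x ∂μ := by
    intro s h k hh hk
    have hms : MeasurableSet {z : X × ℝ | ENNReal.ofReal z.2 < h z.1} :=
      measurableSet_lt (ENNReal.measurable_ofReal.comp measurable_snd) (hh.comp measurable_fst)
    have e1 : ∀ x, k x * ∫⁻ t in Ioi (0 : ℝ), {t : ℝ | ENNReal.ofReal t < h x}.indicator
        (fun t => ENNReal.ofReal (t ^ (s - 1))) t = ∫⁻ t in Ioi (0 : ℝ),
        {z : X × ℝ | ENNReal.ofReal z.2 < h z.1}.indicator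
          (fun z => ENNReal.ofReal (z.2 ^ (s - 1)) * k z.1) (x, t) := by
      intro x
      rw [← lintegral_const_mul]
      · refine lintegral_congr fun t => ?_
        by_cases ht : ENNReal.ofReal t < h x
        · rw [indicator_of_mem (by exact ht), indicator_of_mem (by exact ht), mul_comm]
        · rw [indicator_of_notMem (by exact ht), indicator_of_notMem (by exact ht), mul_zero]
      · exact (by fun_prop : Measurable fun t : ℝ => ENNReal.ofReal (t ^ (s - 1))).indicator
          (ENNReal.measurable_ofReal measurableSet_Iio)
    simp_rw [e1]
    rw [lintegral_lintegral_swap]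
    · refine lintegral_congr fun t => ?_
      rw [← lintegral_const_mul]
      · refine lintegral_congr fun x => ?_
        by_cases ht : ENNReal.ofReal t < h x
        · rw [indicator_of_mem (by exact ht), indicator_of_mem (by exact ht)]
        · rw [indicator_of_notMem (by exact ht), indicator_of_notMem (by exact ht), mul_zero]
      · exact hk.indicator (measurableSet_lt measurable_const hh)
    · refine (Measurable.indicator ?_ hms).aemeasurable
      exact (by fun_prop : Measurable fun z : X × ℝ => ENNReal.ofReal (z.2 ^ (s - 1))).mul
        (hk.comp measurable_fst)
  have hL : ∀ x, ballMaximal μ g x ^ p = ENNReal.ofReal p * (1 *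
      ∫⁻ t in Ioi (0 : ℝ), {t : ℝ | ENNReal.ofReal t < ballMaximal μ g x}.indicator
        (fun t => ENNReal.ofReal (t ^ (p - 1))) t) := by
    intro x
    rw [lintegral_Ioi_indicator_rpow hp0, one_mul, ← mul_assoc, ← ENNReal.ofReal_mul hp0.le,
      mul_inv_cancel₀ hp0.ne', ENNReal.ofReal_one, one_mul]
  have hR : ∀ x, g x * ∫⁻ t in Ioi (0 : ℝ), {t : ℝ | ENNReal.ofReal t < 2 * g x}.indicator
        (fun t => ENNReal.ofReal (t ^ (p - 1 - 1))) t =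
      (ENNReal.ofReal (p - 1)⁻¹ * 2 ^ (p - 1)) * g x ^ p := by
    intro x
    rw [lintegral_Ioi_indicator_rpow (by linarith), ENNReal.mul_rpow_of_nonneg _ _ (by linarith)]
    have : g x ^ p = g x * g x ^ (p - 1) := by
      nth_rewrite 2 [← ENNReal.rpow_one (g x)]
      rw [← ENNReal.rpow_add_of_nonneg _ _ zero_le_one (by linarith)]
      congr 1; ring
    rw [this]; ring
  have hgp : Measurable fun x => g x ^ p := hg.pow_const p
  rw [lintegral_congr hL, lintegral_const_mul' _ _ ENNReal.ofReal_ne_top,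
    hswap p _ (fun _ => 1) hM measurable_const, mul_assoc (ENNReal.ofReal p), mul_assoc (2 * D),
    ← lintegral_const_mul _ hgp, ← lintegral_congr hR,
    hswap (p - 1) _ g (hg.const_mul 2) hg]
  gcongr
  rw [← lintegral_const_mul' _ _ (by finiteness)]
  refine setLIntegral_mono' measurableSet_Ioi fun t (ht : 0 < t) => ?_
  set t' := ENNReal.ofReal (t / 2) with ht'
  have htt : ENNReal.ofReal t = t' + t' := by
    rw [ht', ← ENNReal.ofReal_add (by positivity) (by positivity), add_halves]
  have ht'0 : t' ≠ ∞ := ENNReal.ofReal_ne_top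
  have hsub : {x | ENNReal.ofReal t < ballMaximal μ g x} ⊆
      {x | t' < ballMaximal μ ({y | t' < g y}.indicator g) x} := by
    intro x (hx : ENNReal.ofReal t < ballMaximal μ g x)
    have := hx.trans_le (ballMaximal_le_add μ g t' x)
    rw [htt] at this
    exact lt_of_add_lt_add_right this
  have hset : {x | ENNReal.ofReal t < 2 * g x} = {x | t' < g x} := by
    ext x
    simp only [mem_ofPred_eq]
    rw [htt, ← two_mul, ENNReal.mul_lt_mul_iff_right (by norm_num) (by norm_num)]
  rw [hset, lintegral_indicator_const (measurableSet_lt measurable_const hM), one_mul]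
  have hw := mul_measure_lt_ballMaximal_le hD ({y | t' < g y}.indicator g) t'
  have hpow : ENNReal.ofReal (t ^ (p - 1)) = ENNReal.ofReal (t ^ (p - 1 - 1)) * (2 * t') := by
    rw [two_mul, ← htt, ← ENNReal.ofReal_mul (by positivity), Real.rpow_sub_one ht.ne' (p - 1),
      div_mul_cancel₀ _ ht.ne']
  calc _ ≤ ENNReal.ofReal (t ^ (p - 1)) *
        μ {x | t' < ballMaximal μ ({y | t' < g y}.indicator g) x} := by gcongr
    _ = 2 * ENNReal.ofReal (t ^ (p - 1 - 1)) *
        (t' * μ {x | t' < ballMaximal μ ({y | t' < g y}.indicator g) x}) := by rw [hpow]; ring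
    _ ≤ 2 * ENNReal.ofReal (t ^ (p - 1 - 1)) *
        (D * ∫⁻ x, {y | t' < g y}.indicator g x ∂μ) := by gcongr
    _ = _ := by ring

end BallMaximal

section Muckenhoupt

variable {n : ℕ}

/-- A weight `w` and its dual weight `σ` satisfying the Muckenhoupt condition on balls, in a form
symmetric in `(p, w)` and `(q, σ)`. -/
structure MuckenhouptPair (p q : ℝ) (w σ : (Fin n → ℝ) → ℝ≥0∞) : Prop where
  holder : p.HolderConjugate q
  measurable_left : Measurable w
  measurable_right : Measurable σ
  mul_eq_one : ∀ x, w x ^ (1 / p) * σ x ^ (1 / q) = 1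
  bound : ∃ K : ℝ≥0∞, K ≠ ∞ ∧ ∀ (c : Fin n → ℝ) (r : ℝ), 0 < r →
    (∫⁻ x in ball c r, w x) ^ (1 / p) * (∫⁻ x in ball c r, σ x) ^ (1 / q) ≤ K * volume (ball c r)

namespace MuckenhouptPair

variable {p q : ℝ} {w σ : (Fin n → ℝ) → ℝ≥0∞}

theorem symm (h : MuckenhouptPair p q w σ) : MuckenhouptPair q p σ w where
  holder := h.holder.symm
  measurable_left := h.measurable_right
  measurable_right := h.measurable_left
  mul_eq_one x := by rw [mul_comm, h.mul_eq_one]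
  bound := by simpa only [mul_comm] using h.bound

theorem ne_zero (h : MuckenhouptPair p q w σ) (x : Fin n → ℝ) : w x ≠ 0 := by
  intro h0
  have := h.mul_eq_one x
  rw [h0, ENNReal.zero_rpow_of_pos (by simpa using h.holder.pos), zero_mul] at this
  exact zero_ne_one this

theorem ne_top (h : MuckenhouptPair p q w σ) (x : Fin n → ℝ) : w x ≠ ∞ := by
  intro h0
  have h1 := h.mul_eq_one x
  have h2 := h.symm.ne_zero x
  rw [h0, ENNReal.top_rpow_of_pos (by simpa using h.holder.pos), ENNReal.top_mul] at h1
  · exact ENNReal.top_ne_one h1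
  · rw [Ne, ENNReal.rpow_eq_zero_iff_of_pos (by simpa using h.holder.symm.pos)]
    exact h2

theorem div_rpow_mul (h : MuckenhouptPair p q w σ) (a : ℝ≥0∞) (x : Fin n → ℝ) :
    (a / w x) ^ q * w x = a ^ q * σ x := by
  have hq := h.holder.symm.pos
  have hw : w x ^ q ≠ 0 := by simp [h.ne_zero, h.ne_top]
  have hw' : w x ^ q ≠ ∞ := by simp [h.ne_zero, h.ne_top]
  have key : w x = w x ^ q * σ x := by
    have h1 : (w x ^ (1 / p) * σ x ^ (1 / q)) ^ q = 1 := by rw [h.mul_eq_one, ENNReal.one_rpow]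
    rw [ENNReal.mul_rpow_of_nonneg _ _ hq.le, ← ENNReal.rpow_mul, ← ENNReal.rpow_mul,
      one_div_mul_cancel hq.ne', ENNReal.rpow_one, one_div_mul_eq_div,
      h.holder.symm.div_conj_eq_sub_one] at h1
    calc w x = w x ^ (1 : ℝ) * (w x ^ (q - 1) * σ x) := by rw [h1, mul_one, ENNReal.rpow_one]
      _ = _ := by
        rw [← mul_assoc, ← ENNReal.rpow_add _ _ (h.ne_zero x) (h.ne_top x)]
        congr 2; ring
  rw [ENNReal.div_rpow_of_nonneg _ _ hq.le, div_eq_mul_inv, mul_assoc]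
  congr 1
  nth_rewrite 2 [key]
  rw [← mul_assoc, ENNReal.inv_mul_cancel hw hw', one_mul]

theorem lintegral_ball_ne_zero (h : MuckenhouptPair p q w σ) (c : Fin n → ℝ) {r : ℝ}
    (hr : 0 < r) : ∫⁻ x in ball c r, w x ≠ 0 := by
  rw [← pos_iff_ne_zero, setLIntegral_pos_iff h.measurable_left]
  have : Function.support w = univ := by
    ext x; simpa using h.ne_zero x
  rw [this, univ_inter]
  exact measure_ball_pos _ _ hr

theorem lintegral_ball_ne_top (h : MuckenhouptPair p q w σ) (c : Fin n → ℝ) {r : ℝ}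
    (hr : 0 < r) : ∫⁻ x in ball c r, w x ≠ ∞ := by
  obtain ⟨K, hK, hb⟩ := h.bound
  have h1 := hb c r hr
  intro h0
  rw [h0, ENNReal.top_rpow_of_pos (by simpa using h.holder.pos), ENNReal.top_mul, top_le_iff] at h1
  · exact ENNReal.mul_ne_top hK measure_ball_lt_top.ne h1
  · rw [Ne, ENNReal.rpow_eq_zero_iff_of_pos (by simpa using h.holder.symm.pos)]
    exact h.symm.lintegral_ball_ne_zero c hr

/-- Subsets of a ball of large relative Lebesgue measure have large relative `w`-measure. -/
theorem exists_measure_mul_le (h : MuckenhouptPair p q w σ) :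
    ∃ K : ℝ≥0∞, K ≠ ∞ ∧ ∀ (c : Fin n → ℝ) (r : ℝ), 0 < r → ∀ E ⊆ ball c r,
      volume E ^ p * ∫⁻ x in ball c r, w x ≤
        K * volume (ball c r) ^ p * ∫⁻ x in E, w x := by
  obtain ⟨K, hK, hb⟩ := h.bound
  have hp := h.holder.pos
  refine ⟨K ^ p, by finiteness, fun c r hr E hE => ?_⟩
  have h1 : volume E ≤ (∫⁻ x in E, w x) ^ (1 / p) * (∫⁻ x in ball c r, σ x) ^ (1 / q) := by
    calc volume E = ∫⁻ x in E, ((fun x => w x ^ (1 / p)) * fun x => σ x ^ (1 / q)) x := by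
          simp only [Pi.mul_apply, h.mul_eq_one, setLIntegral_one]
      _ ≤ (∫⁻ x in E, (w x ^ (1 / p)) ^ p) ^ (1 / p) *
          (∫⁻ x in E, (σ x ^ (1 / q)) ^ q) ^ (1 / q) :=
        ENNReal.lintegral_mul_le_Lp_mul_Lq _ h.holder
          (h.measurable_left.pow_const _).aemeasurable (h.measurable_right.pow_const _).aemeasurable
      _ = (∫⁻ x in E, w x) ^ (1 / p) * (∫⁻ x in E, σ x) ^ (1 / q) := by
        simp only [← ENNReal.rpow_mul, one_div_mul_cancel hp.ne',
          one_div_mul_cancel h.holder.symm.pos.ne', ENNReal.rpow_one]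
      _ ≤ _ := by
        have := h.holder.symm.pos
        gcongr
  have h2 : volume E * (∫⁻ x in ball c r, w x) ^ (1 / p) ≤
      (K * volume (ball c r)) * (∫⁻ x in E, w x) ^ (1 / p) := by
    calc _ ≤ ((∫⁻ x in E, w x) ^ (1 / p) * (∫⁻ x in ball c r, σ x) ^ (1 / q)) *
          (∫⁻ x in ball c r, w x) ^ (1 / p) := by gcongr
      _ = ((∫⁻ x in ball c r, w x) ^ (1 / p) * (∫⁻ x in ball c r, σ x) ^ (1 / q)) *
          (∫⁻ x in E, w x) ^ (1 / p) := by ring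
      _ ≤ _ := mul_le_mul' (hb c r hr) le_rfl
  have h3 := ENNReal.rpow_le_rpow h2 hp.le
  simpa only [ENNReal.mul_rpow_of_nonneg _ _ hp.le, ← ENNReal.rpow_mul, one_div_mul_cancel hp.ne',
    ENNReal.rpow_one] using h3

theorem doubling (h : MuckenhouptPair p q w σ) :
    ∃ D : ℝ≥0∞, D ≠ ∞ ∧ ∀ (c : Fin n → ℝ) (r : ℝ), 0 < r →
      volume.withDensity w (closedBall c (5 * r)) ≤ D * volume.withDensity w (ball c r) := by
  obtain ⟨K, hK, hb⟩ := h.exists_measure_mul_le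
  have hp := h.holder.pos
  refine ⟨K * (ENNReal.ofReal (6 ^ n)) ^ p, by finiteness, fun c r hr => ?_⟩
  have h1 := hb c (6 * r) (by positivity) (ball c r) (ball_subset_ball (by linarith))
  have hv : volume (ball c (6 * r)) = ENNReal.ofReal (6 ^ n) * volume (ball c r) := by
    rw [Measure.addHaar_ball_mul_of_pos _ _ (by norm_num), Module.finrank_fin_fun,
      Measure.addHaar_ball_center volume c r]
  have h0 : volume (ball c r) ≠ 0 := (measure_ball_pos _ _ hr).ne'
  have ht : volume (ball c r) ≠ ∞ := measure_ball_lt_top.ne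
  have h0' : volume (ball c r) ^ p ≠ 0 := by simp [h0, ht]
  have ht' : volume (ball c r) ^ p ≠ ∞ := by simp [h0, ht]
  rw [hv, ENNReal.mul_rpow_of_nonneg _ _ hp.le] at h1
  calc _ ≤ volume.withDensity w (ball c (6 * r)) :=
        measure_mono (closedBall_subset_ball (by linarith))
    _ = ∫⁻ x in ball c (6 * r), w x := withDensity_apply _ measurableSet_ball
    _ ≤ K * (ENNReal.ofReal (6 ^ n)) ^ p * ∫⁻ x in ball c r, w x := by
      rw [← ENNReal.mul_le_mul_iff_right h0' ht']
      exact h1.trans (le_of_eq (by ring))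
    _ = _ := by rw [withDensity_apply _ measurableSet_ball]

/-- Lerner's pointwise bound of the maximal function by weighted maximal functions. -/
theorem exists_ballMaximal_le (h : MuckenhouptPair p q w σ) :
    ∃ K : ℝ≥0∞, K ≠ ∞ ∧ ∀ f : (Fin n → ℝ) → ℝ≥0∞, Measurable f → ∀ x,
      ballMaximal volume f x ^ (p - 1) ≤ K * ballMaximal (volume.withDensity w)
        (fun y => ballMaximal (volume.withDensity σ) (fun z => f z / σ z) y ^ (p - 1) / w y) x := by
  obtain ⟨K, hK, hb⟩ := h.bound
  have hp := h.holder.pos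
  have hp1 : 0 < p - 1 := h.holder.sub_one_pos
  refine ⟨K ^ p, by finiteness, fun f hf x => ?_⟩
  set G := ballMaximal (volume.withDensity σ) (fun z => f z / σ z) with hG
  have hGm : Measurable G := measurable_ballMaximal _ _
  rw [← ENNReal.le_rpow_inv_iff hp1]
  refine ballMaximal_le_iff.2 fun c r hr hx => ?_
  rw [ENNReal.le_rpow_inv_iff hp1]
  have h0 : volume (ball c r) ≠ 0 := (measure_ball_pos _ _ hr).ne'
  have ht : volume (ball c r) ≠ ∞ := measure_ball_lt_top.ne
  set V := volume (ball c r) with hV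
  have hS0 := h.symm.lintegral_ball_ne_zero c hr
  have hSt := h.symm.lintegral_ball_ne_top c hr
  have hW0 := h.lintegral_ball_ne_zero c hr
  have hWt := h.lintegral_ball_ne_top c hr
  have hb' := ENNReal.rpow_le_rpow (hb c r hr) hp.le
  set S := ∫⁻ x in ball c r, σ x with hS
  set W := ∫⁻ x in ball c r, w x with hW
  have hdiv : ∀ {k : (Fin n → ℝ) → ℝ≥0∞} {ρ : (Fin n → ℝ) → ℝ≥0∞}, Measurable k → Measurable ρ →
      (∀ y, ρ y ≠ 0) → (∀ y, ρ y ≠ ∞) →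
      ∫⁻ y in ball c r, k y / ρ y ∂(volume.withDensity ρ) = ∫⁻ y in ball c r, k y := by
    intro k ρ hk hρ h0 ht
    rw [setLIntegral_withDensity_eq_setLIntegral_mul (g := fun y => k y / ρ y) _ hρ (hk.div hρ)
      measurableSet_ball]
    exact lintegral_congr fun y => ENNReal.mul_div_cancel (h0 y) (ht y)
  have h1 : ∀ y ∈ ball c r, ∫⁻ z in ball c r, f z ≤ S * G y := by
    intro y hy
    have := le_ballMaximal (volume.withDensity σ) (fun z => f z / σ z) hr hy
    rwa [hdiv hf h.measurable_right h.symm.ne_zero h.symm.ne_top,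
      withDensity_apply _ measurableSet_ball, ENNReal.div_le_iff hS0 hSt, mul_comm] at this
  have h2 : (∫⁻ z in ball c r, f z) ^ (p - 1) * V ≤
      S ^ (p - 1) * ∫⁻ y in ball c r, G y ^ (p - 1) := by
    rw [← setLIntegral_const, ← lintegral_const_mul _ (hGm.pow_const _)]
    refine setLIntegral_mono' measurableSet_ball fun y hy => ?_
    rw [← ENNReal.mul_rpow_of_nonneg _ _ hp1.le]
    exact ENNReal.rpow_le_rpow (h1 y hy) hp1.le
  have h3 : W * S ^ (p - 1) ≤ K ^ p * V ^ p := by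
    rw [ENNReal.mul_rpow_of_nonneg _ _ hp.le, ENNReal.mul_rpow_of_nonneg _ _ hp.le,
      ← ENNReal.rpow_mul, ← ENNReal.rpow_mul, one_div_mul_cancel hp.ne', ENNReal.rpow_one,
      one_div_mul_eq_div, h.holder.div_conj_eq_sub_one] at hb'
    exact hb'
  have hVp : V ^ p = V ^ (p - 1) * V := by
    nth_rewrite 3 [← ENNReal.rpow_one V]
    rw [← ENNReal.rpow_add _ _ h0 ht, sub_add_cancel]
  have hV0 : V ^ (p - 1) ≠ 0 := by simp [h0, ht]
  have hVt : V ^ (p - 1) ≠ ∞ := by simp [h0, ht]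
  have h4 : (∫⁻ z in ball c r, f z) ^ (p - 1) * W ≤
      K ^ p * V ^ (p - 1) * ∫⁻ y in ball c r, G y ^ (p - 1) := by
    rw [← ENNReal.mul_le_mul_iff_left h0 ht]
    calc (∫⁻ z in ball c r, f z) ^ (p - 1) * W * V =
          ((∫⁻ z in ball c r, f z) ^ (p - 1) * V) * W := by ring
      _ ≤ (S ^ (p - 1) * ∫⁻ y in ball c r, G y ^ (p - 1)) * W := by gcongr
      _ = (W * S ^ (p - 1)) * ∫⁻ y in ball c r, G y ^ (p - 1) := by ring
      _ ≤ (K ^ p * V ^ p) * ∫⁻ y in ball c r, G y ^ (p - 1) := by gcongr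
      _ = _ := by rw [hVp]; ring
  calc _ ≤ K ^ p * ((∫⁻ y in ball c r, G y ^ (p - 1)) / W) := by
        rw [ENNReal.div_rpow_of_nonneg _ _ hp1.le, ENNReal.div_le_iff hV0 hVt, ← mul_div_assoc,
          ENNReal.div_eq_inv_mul, mul_assoc, ← ENNReal.div_eq_inv_mul,
          ENNReal.le_div_iff_mul_le (Or.inl hW0) (Or.inl hWt)]
        exact h4.trans (le_of_eq (by ring))
    _ ≤ _ := by
        gcongr
        have := le_ballMaximal (volume.withDensity w) (fun y => G y ^ (p - 1) / w y) hr hx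
        rwa [hdiv (hGm.pow_const _) h.measurable_left h.ne_zero h.ne_top,
          withDensity_apply _ measurableSet_ball] at this

/-- Muckenhoupt's theorem. -/
theorem exists_lintegral_ballMaximal_rpow_mul_le (h : MuckenhouptPair p q w σ) :
    ∃ A : ℝ≥0∞, A ≠ ∞ ∧ ∀ f : (Fin n → ℝ) → ℝ≥0∞, Measurable f →
      ∫⁻ x, ballMaximal volume f x ^ p * w x ≤ A * ∫⁻ x, f x ^ p * w x := by
  obtain ⟨K, hK, hb⟩ := h.exists_ballMaximal_le
  obtain ⟨Dw, hDw, hDw'⟩ := h.doubling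
  obtain ⟨Ds, hDs, hDs'⟩ := h.symm.doubling
  obtain ⟨Aw, hAw, hw⟩ := exists_lintegral_ballMaximal_rpow_le hDw hDw' h.holder.symm.lt
  obtain ⟨As, hAs, hs⟩ := exists_lintegral_ballMaximal_rpow_le hDs hDs' h.holder.lt
  have hq := h.holder.symm.pos
  refine ⟨K ^ q * Aw * As, by finiteness, fun f hf => ?_⟩
  have hpow : ∀ a : ℝ≥0∞, (a ^ (p - 1)) ^ q = a ^ p := by
    intro a; rw [← ENNReal.rpow_mul, h.holder.sub_one_mul_conj]
  set G := ballMaximal (volume.withDensity σ) (fun z => f z / σ z) with hG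
  have hGm : Measurable G := measurable_ballMaximal _ _
  have hd : ∀ {ρ k : (Fin n → ℝ) → ℝ≥0∞}, Measurable ρ → Measurable k →
      ∫⁻ x, k x ∂(volume.withDensity ρ) = ∫⁻ x, k x * ρ x := by
    intro ρ k hρ hk
    rw [lintegral_withDensity_eq_lintegral_mul _ hρ hk]
    simp only [Pi.mul_apply, mul_comm]
  have hw1 := hw (fun y => G y ^ (p - 1) / w y) ((hGm.pow_const _).div h.measurable_left)
  rw [hd h.measurable_left ((measurable_ballMaximal _ _).pow_const _),
    hd (k := fun x => (G x ^ (p - 1) / w x) ^ q) h.measurable_left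
      (((hGm.pow_const _).div h.measurable_left).pow_const _)] at hw1
  have hs1 := hs (fun z => f z / σ z) (hf.div h.measurable_right)
  rw [hd h.measurable_right ((measurable_ballMaximal _ _).pow_const _),
    hd (k := fun x => (f x / σ x) ^ p) h.measurable_right
      ((hf.div h.measurable_right).pow_const _)] at hs1
  simp only [h.div_rpow_mul, h.symm.div_rpow_mul, hpow] at hw1 hs1
  calc ∫⁻ x, ballMaximal volume f x ^ p * w x
      ≤ ∫⁻ x, K ^ q * (ballMaximal (volume.withDensity w)
          (fun y => G y ^ (p - 1) / w y) x ^ q * w x) := by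
        refine lintegral_mono fun x => ?_
        rw [← mul_assoc, ← ENNReal.mul_rpow_of_nonneg _ _ hq.le, ← hpow]
        gcongr
        exact hb f hf x
    _ = K ^ q * ∫⁻ x, ballMaximal (volume.withDensity w)
          (fun y => G y ^ (p - 1) / w y) x ^ q * w x :=
        lintegral_const_mul _ (((measurable_ballMaximal _ _).pow_const _).mul h.measurable_left)
    _ ≤ K ^ q * (Aw * (As * ∫⁻ x, f x ^ p * w x)) := by
        gcongr
        exact hw1.trans (by gcongr)
    _ = _ := by ring

end MuckenhouptPair

end Muckenhoupt

section AOne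

variable {n : ℕ}

theorem isCube_iff_exists_closedBall {Q : Set (Fin n → ℝ)} :
    IsCube Q ↔ ∃ c r, 0 < r ∧ Q = closedBall c r := by
  constructor
  · rintro ⟨a, l, hl, rfl⟩
    refine ⟨fun i => a i + l / 2, l / 2, by positivity, ?_⟩
    rw [closedBall_pi _ (by positivity)]
    refine pi_congr rfl fun i _ => ?_
    rw [Real.closedBall_eq_Icc]
    congr 1 <;> ring
  · rintro ⟨c, r, hr, rfl⟩
    refine ⟨fun i => c i - r, 2 * r, by positivity, ?_⟩
    rw [closedBall_pi _ hr.le]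
    refine pi_congr rfl fun i _ => ?_
    rw [Real.closedBall_eq_Icc]
    congr 1; ring

/-- Extended-valued, everywhere positive `A₁` weights. -/
structure IsAOne (u : (Fin n → ℝ) → ℝ≥0∞) : Prop where
  measurable : Measurable u
  ne_zero : ∀ x, u x ≠ 0
  bound : ∃ C : ℝ≥0∞, C ≠ ∞ ∧ ∀ (c : Fin n → ℝ) (r : ℝ), 0 < r → ∀ x ∈ closedBall c r,
    ∫⁻ y in closedBall c r, u y ≤ C * u x * volume (closedBall c r)

namespace IsAOne

variable {u v : (Fin n → ℝ) → ℝ≥0∞}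

theorem one : IsAOne fun _ : Fin n → ℝ => 1 where
  measurable := measurable_const
  ne_zero _ := one_ne_zero
  bound := ⟨1, ENNReal.one_ne_top, fun c r _ x _ => by simp⟩

theorem one_add (hu : IsAOne u) : IsAOne fun x => 1 + u x where
  measurable := hu.measurable.const_add 1
  ne_zero x := by simp
  bound := by
    obtain ⟨C, hC, hb⟩ := hu.bound
    refine ⟨1 + C, by finiteness, fun c r hr x hx => ?_⟩
    rw [lintegral_add_left measurable_const, setLIntegral_one]
    calc _ ≤ volume (closedBall c r) + C * u x * volume (closedBall c r) := by
          gcongr; exact hb c r hr x hx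
      _ = (1 * 1 + C * u x) * volume (closedBall c r) := by ring
      _ ≤ _ := by
        gcongr
        calc 1 * 1 + C * u x ≤ 1 * (1 + u x) + C * (1 + u x) := by
              gcongr
              · exact le_self_add
              · exact le_add_self
          _ = _ := by ring

theorem min_one (hu : IsAOne u) : IsAOne fun x => min (u x) 1 where
  measurable := hu.measurable.min measurable_const
  ne_zero x := by simpa using hu.ne_zero x
  bound := by
    obtain ⟨C, hC, hb⟩ := hu.bound
    refine ⟨1 + C, by finiteness, fun c r hr x hx => ?_⟩
    rcases le_total (u x) 1 with h | h
    · rw [min_eq_left h]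
      calc _ ≤ ∫⁻ y in closedBall c r, u y := lintegral_mono fun y => min_le_left _ _
        _ ≤ _ := hb c r hr x hx
        _ ≤ _ := by gcongr; exact le_add_self
    · rw [min_eq_right h]
      calc _ ≤ ∫⁻ y in closedBall c r, 1 := lintegral_mono fun y => min_le_right _ _
        _ = 1 * 1 * volume (closedBall c r) := by simp
        _ ≤ _ := by gcongr; exact le_self_add

theorem lintegral_closedBall_ne_top (hu : IsAOne u) (hfin : ∀ᵐ x, u x ≠ ∞) (c : Fin n → ℝ)
    {r : ℝ} (hr : 0 < r) : ∫⁻ x in closedBall c r, u x ≠ ∞ := by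
  obtain ⟨C, hC, hb⟩ := hu.bound
  obtain ⟨x, hx, hxu⟩ : ∃ x ∈ closedBall c r, u x ≠ ∞ := by
    by_contra! h
    have h0 : volume (closedBall c r) = 0 := by
      refine measure_mono_null (fun x hx => ?_) (ae_iff.1 hfin)
      simpa using h x hx
    exact (measure_closedBall_pos volume c hr).ne' h0
  have := measure_closedBall_lt_top (x := c) (r := r) (μ := volume)
  exact ne_top_of_le_ne_top (by finiteness) (hb c r hr x hx)

theorem lintegral_closedBall_ne_zero (hu : IsAOne u) (c : Fin n → ℝ) {r : ℝ} (hr : 0 < r) :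
    ∫⁻ x in closedBall c r, u x ≠ 0 := by
  rw [← pos_iff_ne_zero, setLIntegral_pos_iff hu.measurable]
  have : Function.support u = univ := by
    ext x; simpa using hu.ne_zero x
  rw [this, univ_inter]
  exact measure_closedBall_pos _ _ hr

theorem memA1_toReal (hu : IsAOne u) (hfin : ∀ᵐ x, u x ≠ ∞) :
    MemA1 univ fun x => (u x).toReal := by
  refine ⟨⟨hu.measurable.ennreal_toReal, ?_, ?_⟩, ?_⟩
  · rw [Measure.restrict_univ]
    filter_upwards [hfin] with x hx using ENNReal.toReal_pos (hu.ne_zero x) hx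
  · intro Q hQ _
    obtain ⟨c, r, hr, rfl⟩ := isCube_iff_exists_closedBall.1 hQ
    exact integrable_toReal_of_lintegral_ne_top hu.measurable.aemeasurable
      (hu.lintegral_closedBall_ne_top hfin c hr)
  · obtain ⟨C, hC, hb⟩ := hu.bound
    refine ⟨C.toReal, ?_⟩
    rw [Measure.restrict_univ]
    filter_upwards [hfin] with x hx
    rw [ENNReal.ofReal_mul ENNReal.toReal_nonneg, ENNReal.ofReal_toReal hC,
      ENNReal.ofReal_toReal hx]
    refine iSup_le fun Q => iSup_le fun hQ => iSup_le fun _ => iSup_le fun hxQ => ?_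
    obtain ⟨c, r, hr, rfl⟩ := isCube_iff_exists_closedBall.1 hQ
    rw [mul_comm, ← div_eq_mul_inv]
    refine ENNReal.div_le_of_le_mul (le_trans (lintegral_mono fun y => ?_) (hb c r hr x hxQ))
    rw [abs_of_nonneg ENNReal.toReal_nonneg]
    exact ENNReal.ofReal_toReal_le

theorem _root_.ENNReal.rpow_mul_rpow_neg_le {a b C : ℝ≥0∞} {s : ℝ} (hs : 0 ≤ s)
    (h : a ≤ C * b) : a ^ s * b ^ (-s) ≤ C ^ s := by
  rw [ENNReal.rpow_neg, ← div_eq_mul_inv]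
  refine ENNReal.div_le_of_le_mul ?_
  rw [← ENNReal.mul_rpow_of_nonneg _ _ hs]
  exact ENNReal.rpow_le_rpow h hs

/-- Products `v * u ^ (1 - p)` of `A₁` weights are `A_p` weights. -/
theorem memApGT1_mul_rpow (hv : IsAOne v) (hu : IsAOne u) (hv1 : ∀ x, v x ≤ 1)
    (hu1 : ∀ x, 1 ≤ u x) (hfin : ∀ᵐ x, u x ≠ ∞) {p : ℝ} (hp : 1 < p) :
    MemApGT1 univ p fun x => (v x * u x ^ (1 - p)).toReal := by
  have hp1 : 0 < p - 1 := sub_pos.2 hp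
  have hWm : Measurable fun x => v x * u x ^ (1 - p) :=
    hv.measurable.mul (hu.measurable.pow_const _)
  have hup : ∀ x, u x ^ (1 - p) ≤ 1 := fun x =>
    ENNReal.rpow_le_one_of_one_le_of_neg (hu1 x) (by linarith)
  have hW1 : ∀ x, v x * u x ^ (1 - p) ≤ 1 := fun x => mul_le_one' (hv1 x) (hup x)
  have hvtop : ∀ x, v x ≠ ∞ := fun x => ne_top_of_le_ne_top ENNReal.one_ne_top (hv1 x)
  have hWt : ∀ x, v x * u x ^ (1 - p) ≠ ∞ := fun x =>
    ne_top_of_le_ne_top ENNReal.one_ne_top (hW1 x)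
  have hu0 : ∀ x, u x ≠ ∞ → u x ^ (1 - p) ≠ 0 := fun x hx => by
    simp [hx, hu.ne_zero x]
  refine ⟨⟨hWm.ennreal_toReal, ?_, ?_⟩, ?_⟩
  · rw [Measure.restrict_univ]
    filter_upwards [hfin] with x hx using
      ENNReal.toReal_pos (mul_ne_zero (hv.ne_zero x) (hu0 x hx)) (hWt x)
  · intro Q hQ _
    obtain ⟨c, r, hr, rfl⟩ := isCube_iff_exists_closedBall.1 hQ
    refine integrable_toReal_of_lintegral_ne_top hWm.aemeasurable ?_
    refine ne_top_of_le_ne_top ?_ (lintegral_mono hW1)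
    rw [setLIntegral_one]
    exact measure_closedBall_lt_top.ne
  obtain ⟨Cv, hCv, hbv⟩ := hv.bound
  obtain ⟨Cu, hCu, hbu⟩ := hu.bound
  refine ⟨Cu ^ (p - 1) * Cv, by finiteness, fun Q hQ _ => ?_⟩
  obtain ⟨c, r, hr, rfl⟩ := isCube_iff_exists_closedBall.1 hQ
  have hV0 : volume (closedBall c r) ≠ 0 := (measure_closedBall_pos volume c hr).ne'
  have hVt : volume (closedBall c r) ≠ ∞ := measure_closedBall_lt_top.ne
  set B := closedBall c r with hB
  set e : ℝ := 1 - p / (p - 1) with he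
  have he' : -e * (p - 1) = 1 := by rw [he]; field_simp; ring
  have he0 : 0 < -e := pos_of_mul_pos_left (by rw [he']; exact one_pos) hp1.le
  have hσ : ∫⁻ x in B, ENNReal.ofReal ((v x * u x ^ (1 - p)).toReal ^ e) =
      ∫⁻ x in B, v x ^ e * u x := by
    refine lintegral_congr_ae (ae_restrict_of_ae ?_)
    filter_upwards [hfin] with x hx
    rw [ENNReal.toReal_rpow, ENNReal.ofReal_toReal,
      ENNReal.mul_rpow_of_ne_top (hvtop x), ← ENNReal.rpow_mul]
    · rw [show (1 - p) * e = 1 by linarith, ENNReal.rpow_one]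
    · simp [hx, hu.ne_zero x]
    · exact ENNReal.rpow_ne_top_of_ne_zero (mul_ne_zero (hv.ne_zero x) (hu0 x hx)) (hWt x)
  simp only [ENNReal.ofReal_toReal (hWt _)]
  rw [hσ]
  set V := volume B
  set mu := V⁻¹ * ∫⁻ x in B, u x with hmu
  set mv := V⁻¹ * ∫⁻ x in B, v x with hmv
  have hVi0 : V⁻¹ ≠ 0 := ENNReal.inv_ne_zero.2 hVt
  have hVit : V⁻¹ ≠ ∞ := ENNReal.inv_ne_top.2 hV0
  have hmu0 : mu ≠ 0 := mul_ne_zero hVi0 (hu.lintegral_closedBall_ne_zero c hr)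
  have hmut : mu ≠ ∞ := ENNReal.mul_ne_top hVit (hu.lintegral_closedBall_ne_top hfin c hr)
  have hmv0 : mv ≠ 0 := mul_ne_zero hVi0 (hv.lintegral_closedBall_ne_zero c hr)
  have hmvt : mv ≠ ∞ :=
    ENNReal.mul_ne_top hVit (hv.lintegral_closedBall_ne_top (ae_of_all _ hvtop) c hr)
  have hmule : ∀ x ∈ B, mu ≤ Cu * u x := fun x hx => by
    rw [hmu, mul_comm, ← div_eq_mul_inv]
    exact ENNReal.div_le_of_le_mul (hbu c r hr x hx)
  have hmvle : ∀ x ∈ B, mv ≤ Cv * v x := fun x hx => by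
    rw [hmv, mul_comm, ← div_eq_mul_inv]
    exact ENNReal.div_le_of_le_mul (hbv c r hr x hx)
  have h1 : mu ^ (p - 1) * (V⁻¹ * ∫⁻ x in B, v x * u x ^ (1 - p)) ≤ Cu ^ (p - 1) * mv := by
    rw [hmv, mul_left_comm, mul_left_comm _ V⁻¹, ← lintegral_const_mul _ hWm,
      ← lintegral_const_mul _ hv.measurable]
    gcongr 1
    refine setLIntegral_mono' measurableSet_closedBall fun x hx => ?_
    calc mu ^ (p - 1) * (v x * u x ^ (1 - p)) = (mu ^ (p - 1) * u x ^ (-(p - 1))) * v x := by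
          rw [neg_sub]; ring
      _ ≤ _ := by
        gcongr
        exact ENNReal.rpow_mul_rpow_neg_le hp1.le (hmule x hx)
  have h2 : mv ^ (-e) * (V⁻¹ * ∫⁻ x in B, v x ^ e * u x) ≤ Cv ^ (-e) * mu := by
    rw [hmu, mul_left_comm, mul_left_comm _ V⁻¹,
      ← lintegral_const_mul (f := fun x => v x ^ e * u x) _
        ((hv.measurable.pow_const e).mul hu.measurable),
      ← lintegral_const_mul _ hu.measurable]
    gcongr 1
    refine setLIntegral_mono' measurableSet_closedBall fun x hx => ?_
    calc mv ^ (-e) * (v x ^ e * u x) = (mv ^ (-e) * v x ^ (- -e)) * u x := by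
          rw [neg_neg]; ring
      _ ≤ _ := by
        gcongr
        exact ENNReal.rpow_mul_rpow_neg_le he0.le (hmvle x hx)
  have h3 := ENNReal.rpow_le_rpow h2 hp1.le
  rw [ENNReal.mul_rpow_of_nonneg (mv ^ (-e)) _ hp1.le,
    ENNReal.mul_rpow_of_nonneg (Cv ^ (-e)) _ hp1.le,
    ← ENNReal.rpow_mul, ← ENNReal.rpow_mul, he', ENNReal.rpow_one, ENNReal.rpow_one] at h3
  have ha0 : mu ^ (p - 1) * mv ≠ 0 := mul_ne_zero (by simp [hmu0, hmut]) hmv0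
  have hat : mu ^ (p - 1) * mv ≠ ∞ := ENNReal.mul_ne_top (by simp [hmu0, hmut]) hmvt
  rw [← ENNReal.mul_le_mul_iff_right ha0 hat]
  calc _ = (mu ^ (p - 1) * (V⁻¹ * ∫⁻ x in B, v x * u x ^ (1 - p))) *
        (mv * (V⁻¹ * ∫⁻ x in B, v x ^ e * u x) ^ (p - 1)) := by ring
    _ ≤ (Cu ^ (p - 1) * mv) * (Cv * mu ^ (p - 1)) := mul_le_mul' h1 h3
    _ = _ := by ring

end IsAOne

namespace MuckenhouptPair

variable {p q : ℝ} {w σ : (Fin n → ℝ) → ℝ≥0∞}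

theorem one (hpq : p.HolderConjugate q) :
    MuckenhouptPair p q (fun _ : Fin n → ℝ => 1) (fun _ => 1) where
  holder := hpq
  measurable_left := measurable_const
  measurable_right := measurable_const
  mul_eq_one x := by simp
  bound := by
    refine ⟨1, ENNReal.one_ne_top, fun c r hr => ?_⟩
    rw [setLIntegral_one, ← ENNReal.rpow_add _ _ (measure_ball_pos _ _ hr).ne'
      measure_ball_lt_top.ne, one_div, one_div, hpq.inv_add_inv_eq_one, ENNReal.rpow_one, one_mul]

theorem _root_.MemApGT1.exists_muckenhouptPair {p : ℝ} (hp : 1 < p) {w : (Fin n → ℝ) → ℝ}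
    (hw : MemApGT1 univ p w) :
    ∃ w' σ, MuckenhouptPair p p.conjExponent w' σ ∧
      w' =ᵐ[volume] fun x => ENNReal.ofReal (w x) := by
  obtain ⟨⟨hm, hpos, hloc⟩, C, hC, hb⟩ := hw
  rw [Measure.restrict_univ] at hpos
  have hpq := Real.HolderConjugate.conjExponent hp
  have hp0 := hpq.pos
  have hq0 := hpq.symm.pos
  set q := p.conjExponent with hq
  have hq' : p / (p - 1) = q := rfl
  let w' : (Fin n → ℝ) → ℝ := {x | 0 < w x}.piecewise w 1
  have hw'm : Measurable w' :=
    Measurable.piecewise (measurableSet_lt measurable_const hm) hm measurable_const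
  have hw'pos : ∀ x, 0 < w' x := fun x => by
    by_cases h : 0 < w x
    · simp [w', h]
    · simp [w', h]
  have hw'eq : w' =ᵐ[volume] w := by
    filter_upwards [hpos] with x hx
    simp [w', hx]
  refine ⟨fun x => ENNReal.ofReal (w' x), fun x => ENNReal.ofReal (w' x ^ (1 - q)), ?_, ?_⟩
  · refine ⟨hpq, hw'm.ennreal_ofReal, (hw'm.pow_const _).ennreal_ofReal, fun x => ?_, ?_⟩
    · rw [ENNReal.ofReal_rpow_of_pos (hw'pos x),
        ENNReal.ofReal_rpow_of_pos (by have := hw'pos x; positivity),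
        ← ENNReal.ofReal_mul (by have := hw'pos x; positivity), ← Real.rpow_mul (hw'pos x).le,
        ← Real.rpow_add (hw'pos x)]
      have : 1 / p + (1 - q) * (1 / q) = 0 := by
        have h1 := hpq.inv_add_inv_eq_one
        have h2 : q * (1 / q) = 1 := by field_simp
        rw [sub_mul, h2, one_div, one_div]; linarith
      rw [this, Real.rpow_zero, ENNReal.ofReal_one]
    · refine ⟨C ^ (1 / p), by finiteness, fun c r hr => ?_⟩
      have hV0 : volume (ball c r) ≠ 0 := (measure_ball_pos _ _ hr).ne'
      have hVt : volume (ball c r) ≠ ∞ := measure_ball_lt_top.ne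
      have h1 := hb (closedBall c r) (isCube_iff_exists_closedBall.2 ⟨c, r, hr, rfl⟩)
        (subset_univ _)
      have hvol : volume (closedBall c r) = volume (ball c r) := by
        rw [Measure.addHaar_closedBall _ _ hr.le, Measure.addHaar_ball_of_pos _ _ hr]
      have hle : ∀ g : ℝ → ℝ, ∫⁻ x in ball c r, ENNReal.ofReal (g (w' x)) ≤
          ∫⁻ x in closedBall c r, ENNReal.ofReal (g (w x)) := fun g => by
        calc _ ≤ ∫⁻ x in closedBall c r, ENNReal.ofReal (g (w' x)) :=
              lintegral_mono_set ball_subset_closedBall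
          _ = _ := lintegral_congr_ae (ae_restrict_of_ae (by
              filter_upwards [hw'eq] with x hx; rw [hx]))
      have h2 := hle id
      have h3 := hle fun y => y ^ (1 - q)
      simp only [id] at h2
      rw [hvol, hq'] at h1
      set V := volume (ball c r)
      set a := ∫⁻ x in ball c r, ENNReal.ofReal (w' x)
      set b := ∫⁻ x in ball c r, ENNReal.ofReal (w' x ^ (1 - q))
      have h4 : (V⁻¹ * a) * (V⁻¹ * b) ^ (p - 1) ≤ C := by
        refine le_trans ?_ h1
        have := hpq.sub_one_pos.le
        gcongr
      have h5 := ENNReal.rpow_le_rpow h4 (by positivity : 0 ≤ 1 / p)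
      have hpp : (p - 1) * (1 / p) = 1 / q := by
        have h1 := hpq.inv_add_inv_eq_one
        have h2 : p * (1 / p) = 1 := by field_simp
        rw [sub_mul, h2, one_div, one_div]; linarith
      rw [ENNReal.mul_rpow_of_nonneg _ _ (by positivity), ← ENNReal.rpow_mul, hpp,
        ENNReal.mul_rpow_of_nonneg _ _ (by positivity),
        ENNReal.mul_rpow_of_nonneg _ _ (by positivity)] at h5
      have h6 : V⁻¹ ^ (1 / p) * V⁻¹ ^ (1 / q) = V⁻¹ := by
        rw [← ENNReal.rpow_add _ _ (ENNReal.inv_ne_zero.2 hVt) (ENNReal.inv_ne_top.2 hV0), one_div,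
          one_div, hpq.inv_add_inv_eq_one, ENNReal.rpow_one]
      rw [← ENNReal.div_le_iff hV0 hVt, ENNReal.div_eq_inv_mul, ← h6]
      exact le_trans (le_of_eq (by ring)) h5
  · filter_upwards [hw'eq] with x hx
    rw [hx]

end MuckenhouptPair

end AOne

section RubioDeFrancia

variable {n : ℕ}

theorem ballMaximal_tsum_le {X : Type*} [MetricSpace X] [MeasurableSpace X] (μ : Measure X)
    {g : ℕ → X → ℝ≥0∞} (hg : ∀ k, Measurable (g k)) (x : X) :
    ballMaximal μ (fun y => ∑' k, g k y) x ≤ ∑' k, ballMaximal μ (g k) x := by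
  refine ballMaximal_le_iff.2 fun c r hr hx => ?_
  rw [lintegral_tsum fun k => (hg k).aemeasurable, div_eq_mul_inv, ← ENNReal.tsum_mul_right]
  exact ENNReal.tsum_le_tsum fun k => le_ballMaximal μ (g k) hr hx

theorem ballMaximal_const_mul_le {X : Type*} [MetricSpace X] [MeasurableSpace X] (μ : Measure X)
    {g : X → ℝ≥0∞} (hg : Measurable g) (a : ℝ≥0∞) (x : X) :
    ballMaximal μ (fun y => a * g y) x ≤ a * ballMaximal μ g x := by
  refine ballMaximal_le_iff.2 fun c r hr hx => ?_
  rw [lintegral_const_mul _ hg, mul_div_assoc]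
  gcongr
  exact le_ballMaximal μ g hr hx

theorem IsAOne.of_ballMaximal_le {u : (Fin n → ℝ) → ℝ≥0∞} (hm : Measurable u)
    (h1 : ∀ x ∈ ball 0 1, 1 ≤ u x) {C : ℝ≥0∞} (hC : C ≠ ∞)
    (h : ∀ x, ballMaximal volume u x ≤ C * u x) : IsAOne u where
  measurable := hm
  ne_zero x h0 := by
    have hr : 0 < ‖x‖ + 1 := by positivity
    have h2 := (le_ballMaximal volume u (c := 0) hr
      (by rw [mem_ball_zero_iff]; linarith : x ∈ ball 0 (‖x‖ + 1))).trans (h x)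
    rw [h0, mul_zero, nonpos_iff_eq_zero, ENNReal.div_eq_zero_iff] at h2
    rcases h2 with h2 | h2
    · have h3 : volume (ball (0 : Fin n → ℝ) 1) ≤ ∫⁻ y in ball 0 (‖x‖ + 1), u y := by
        calc volume (ball (0 : Fin n → ℝ) 1) = ∫⁻ y in ball (0 : Fin n → ℝ) 1, 1 := by simp
          _ ≤ ∫⁻ y in ball (0 : Fin n → ℝ) 1, u y := setLIntegral_mono' measurableSet_ball h1
          _ ≤ _ := lintegral_mono_set (ball_subset_ball (by linarith [norm_nonneg x]))
      rw [h2] at h3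
      exact (measure_ball_pos volume (0 : Fin n → ℝ) one_pos).not_ge h3
    · exact measure_ball_lt_top.ne h2
  bound := by
    refine ⟨C * ENNReal.ofReal (2 ^ n), by finiteness, fun c r hr x hx => ?_⟩
    have hx' : x ∈ ball c (2 * r) := closedBall_subset_ball (by linarith) hx
    have h2 := (le_ballMaximal volume u (by positivity) hx').trans (h x)
    rw [ENNReal.div_le_iff (measure_ball_pos volume c (by positivity)).ne'
      measure_ball_lt_top.ne] at h2
    calc _ ≤ ∫⁻ y in ball c (2 * r), u y :=
          lintegral_mono_set (closedBall_subset_ball (by linarith))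
      _ ≤ _ := h2
      _ = _ := by
        rw [Measure.addHaar_ball_mul_of_pos _ _ two_pos, Module.finrank_fin_fun,
          Measure.addHaar_closedBall volume c hr.le, Measure.addHaar_ball_of_pos volume 0 hr]
        ring

/-- The Rubio de Francia algorithm: functions in weighted Lebesgue spaces with Muckenhoupt weights
have `A₁` majorants in the same space. -/
theorem MuckenhouptPair.exists_isAOne_majorant {p q : ℝ} {w σ : (Fin n → ℝ) → ℝ≥0∞}
    (h : MuckenhouptPair p q w σ) {f : (Fin n → ℝ) → ℝ≥0∞} (hf : Measurable f)
    (hfin : ∫⁻ x, f x ^ p * w x ≠ ∞) :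
    ∃ u, IsAOne u ∧ (∀ x, f x ≤ u x) ∧ ∫⁻ x, u x ^ p * w x ≠ ∞ := by
  have hp := h.holder.pos
  obtain ⟨A, hA, hMA⟩ := h.exists_lintegral_ballMaximal_rpow_mul_le
  let f' : (Fin n → ℝ) → ℝ≥0∞ := fun x => f x + (ball 0 1).indicator 1 x
  have hf' : Measurable f' := hf.add (measurable_one.indicator measurableSet_ball)
  set I := ∫⁻ x, f' x ^ p * w x with hI
  have hIt : I ≠ ∞ := by
    have hle : I ≤ ∫⁻ x, 2 ^ (p - 1) * (f x ^ p * w x + (ball 0 1).indicator w x) := by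
      refine lintegral_mono fun x => ?_
      have := ENNReal.rpow_add_le_mul_rpow_add_rpow (f x) ((ball 0 1).indicator 1 x) h.holder.lt.le
      calc f' x ^ p * w x ≤
            2 ^ (p - 1) * (f x ^ p + (ball 0 1).indicator 1 x ^ p) * w x := by gcongr
        _ = 2 ^ (p - 1) * (f x ^ p * w x + (ball 0 1).indicator 1 x ^ p * w x) := by ring
        _ = _ := by
          congr 2
          by_cases hx : x ∈ ball 0 1 <;> simp [hx, hp]
    refine ne_top_of_le_ne_top ?_ hle
    rw [lintegral_const_mul' _ _ (by finiteness),
      lintegral_add_right _ (h.measurable_left.indicator measurableSet_ball),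
      lintegral_indicator measurableSet_ball]
    have := h.lintegral_ball_ne_top 0 one_pos
    finiteness
  set a := A + 1 with ha
  have hat : a ≠ ∞ := by finiteness
  have ha1 : 1 ≤ a := le_add_self
  have ha0 : a ≠ 0 := (one_pos.trans_le ha1).ne'
  let g : ℕ → (Fin n → ℝ) → ℝ≥0∞ := fun k => (ballMaximal volume)^[k] f'
  have hgs : ∀ k, g (k + 1) = ballMaximal volume (g k) := fun k =>
    Function.iterate_succ_apply' _ _ _
  have hgm : ∀ k, Measurable (g k) := by
    intro k
    cases k with
    | zero => exact hf'
    | succ k => rw [hgs]; exact measurable_ballMaximal _ _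
  have hgI : ∀ k, ∫⁻ x, g k x ^ p * w x ≤ a ^ k * I := by
    intro k
    induction k with
    | zero => simp [g, hI]
    | succ k ih =>
      calc ∫⁻ x, g (k + 1) x ^ p * w x ≤ A * ∫⁻ x, g k x ^ p * w x := by
            rw [hgs]; exact hMA _ (hgm k)
        _ ≤ a * (a ^ k * I) := mul_le_mul' le_self_add ih
        _ = _ := by ring
  let b : ℕ → (Fin n → ℝ) → ℝ≥0∞ := fun k x => (2 * a)⁻¹ ^ k * g k x
  let u : (Fin n → ℝ) → ℝ≥0∞ := fun x => ∑' k, 2⁻¹ ^ k * b k x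
  have hbm : ∀ k, Measurable (b k) := fun k => (hgm k).const_mul _
  have hum : Measurable u := Measurable.tsum fun k => (hbm k).const_mul _
  have hfu : ∀ x, f' x ≤ u x := fun x => by
    refine le_trans (le_of_eq ?_) (ENNReal.le_tsum 0)
    simp [b, g]
  have hconst : 4 * a * (2⁻¹ * (2 * a)⁻¹) = 1 := by
    rw [ENNReal.mul_inv (Or.inl two_ne_zero) (Or.inr ha0)]
    calc (4 : ℝ≥0∞) * a * (2⁻¹ * (2⁻¹ * a⁻¹)) = (2 * 2⁻¹) * (2 * 2⁻¹) * (a * a⁻¹) := by ring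
      _ = 1 := by
        rw [ENNReal.mul_inv_cancel two_ne_zero ENNReal.ofNat_ne_top,
          ENNReal.mul_inv_cancel ha0 hat]
        norm_num
  refine ⟨u, IsAOne.of_ballMaximal_le hum ?_ (C := 4 * a) (by finiteness) fun x => ?_,
    fun x => le_self_add.trans (hfu x), ?_⟩
  · intro x hx
    refine le_trans ?_ (hfu x)
    simp [f', hx]
  · calc ballMaximal volume u x ≤ ∑' k, ballMaximal volume (fun y => 2⁻¹ ^ k * b k y) x :=
          ballMaximal_tsum_le _ (fun k => (hbm k).const_mul _) x
      _ ≤ ∑' k, 4 * a * (2⁻¹ ^ (k + 1) * b (k + 1) x) := by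
          refine ENNReal.tsum_le_tsum fun k => ?_
          simp only [b, ← mul_assoc]
          refine (ballMaximal_const_mul_le _ (hgm k) _ x).trans (le_of_eq ?_)
          rw [hgs]
          congr 1
          calc (2⁻¹ : ℝ≥0∞) ^ k * (2 * a)⁻¹ ^ k
              = (4 * a * (2⁻¹ * (2 * a)⁻¹)) * (2⁻¹ ^ k * (2 * a)⁻¹ ^ k) := by
                rw [hconst, one_mul]
            _ = _ := by ring
      _ = 4 * a * ∑' k, 2⁻¹ ^ (k + 1) * b (k + 1) x := ENNReal.tsum_mul_left
      _ ≤ 4 * a * u x := by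
          gcongr
          exact ENNReal.tsum_comp_le_tsum_of_injective (add_left_injective 1)
            (fun k => 2⁻¹ ^ k * b k x)
  · have hup : ∀ x, u x ^ p * w x ≤ 2 ^ p * ∑' k, b k x ^ p * w x := by
      intro x
      rw [ENNReal.tsum_mul_right, ← mul_assoc]
      gcongr
      rw [← ENNReal.le_rpow_inv_iff hp, ENNReal.mul_rpow_of_nonneg _ _ (by positivity),
        ← ENNReal.rpow_mul, mul_inv_cancel₀ hp.ne', ENNReal.rpow_one]
      calc u x ≤ ∑' k, 2⁻¹ ^ k * (∑' k, b k x ^ p) ^ p⁻¹ := by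
            refine ENNReal.tsum_le_tsum fun k => ?_
            gcongr
            rw [ENNReal.le_rpow_inv_iff hp]
            exact ENNReal.le_tsum k
        _ = _ := by
            rw [ENNReal.tsum_mul_right, ENNReal.tsum_geometric, ENNReal.one_sub_inv_two, inv_inv]
    have hb : ∀ k, ∫⁻ x, b k x ^ p * w x ≤ 2⁻¹ ^ k * I := by
      intro k
      have h1 : ((2 * a)⁻¹ ^ k) ^ p ≤ (2 * a)⁻¹ ^ k := by
        refine ENNReal.rpow_le_self_of_le_one (pow_le_one' ?_ k) h.holder.lt.le
        rw [ENNReal.inv_le_one]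
        exact one_le_mul one_le_two ha1
      calc ∫⁻ x, b k x ^ p * w x = ((2 * a)⁻¹ ^ k) ^ p * ∫⁻ x, g k x ^ p * w x := by
            rw [← lintegral_const_mul (f := fun x => g k x ^ p * w x) _
              (((hgm k).pow_const _).mul h.measurable_left)]
            refine lintegral_congr fun x => ?_
            simp only [b]
            rw [ENNReal.mul_rpow_of_nonneg _ _ hp.le, mul_assoc]
        _ ≤ (2 * a)⁻¹ ^ k * (a ^ k * I) := mul_le_mul' h1 (hgI k)
        _ = ((2 * a)⁻¹ * a) ^ k * I := by rw [mul_pow, mul_assoc]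
        _ = _ := by
          rw [ENNReal.mul_inv (Or.inl two_ne_zero) (Or.inr ha0), mul_assoc,
            ENNReal.inv_mul_cancel ha0 hat, mul_one]
    refine ne_top_of_le_ne_top ?_ (lintegral_mono hup)
    rw [lintegral_const_mul' _ _ (by finiteness),
      lintegral_tsum (f := fun k x => b k x ^ p * w x)
        fun k => (((hbm k).pow_const _).mul h.measurable_left).aemeasurable]
    have hsum : ∑' k, ∫⁻ x, b k x ^ p * w x ≤ 2 * I := by
      refine (ENNReal.tsum_le_tsum hb).trans (le_of_eq ?_)
      rw [ENNReal.tsum_mul_right, ENNReal.tsum_geometric, ENNReal.one_sub_inv_two, inv_inv]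
    exact ENNReal.mul_ne_top (by finiteness) (ne_top_of_le_ne_top (by finiteness) hsum)

theorem MuckenhouptPair.ae_ne_top_of_lintegral_ne_top {p q : ℝ} {w σ u : (Fin n → ℝ) → ℝ≥0∞}
    (h : MuckenhouptPair p q w σ) (hu : Measurable u) (hfin : ∫⁻ x, u x ^ p * w x ≠ ∞) :
    ∀ᵐ x, u x ≠ ∞ := by
  filter_upwards [ae_lt_top ((hu.pow_const p).mul h.measurable_left) hfin] with x hx hux
  rw [Pi.mul_apply, hux, ENNReal.top_rpow_of_pos h.holder.pos, ENNReal.top_mul (h.ne_zero x)] at hx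
  exact lt_irrefl _ hx

theorem exists_isAOne_le_one {r : ℝ} (hr : 1 < r) :
    ∃ v : (Fin n → ℝ) → ℝ≥0∞, IsAOne v ∧ (∀ x, v x ≤ 1) ∧ ∫⁻ x, v x ^ r ≠ ∞ := by
  obtain ⟨u, hu, -, hfin⟩ := (MuckenhouptPair.one (n := n)
    (Real.HolderConjugate.conjExponent hr)).exists_isAOne_majorant (f := 0) measurable_zero
    (by simp [zero_lt_one.trans hr])
  refine ⟨fun x => min (u x) 1, hu.min_one, fun x => min_le_right _ _, ?_⟩
  refine ne_top_of_le_ne_top hfin (lintegral_mono fun x => ?_)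
  rw [mul_one]
  exact ENNReal.rpow_le_rpow (min_le_left _ _) (by linarith)

end RubioDeFrancia

section WeakLebesgue

variable {n : ℕ}

namespace MemWeakLp

variable {p : ℝ} {f : (Fin n → ℝ) → ℝ}

theorem exists_measure_le (hp : 0 < p) (hf : MemWeakLp p f) :
    ∃ D : ℝ≥0∞, D ≠ ∞ ∧ ∀ t : ℝ, 0 < t →
      volume {x | t < |f x|} ≤ D * ENNReal.ofReal (t ^ (-p)) := by
  obtain ⟨-, C, hC, h⟩ := hf
  refine ⟨C ^ p, by finiteness, fun t ht => ?_⟩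
  have ht0 : ENNReal.ofReal t ≠ 0 := (ENNReal.ofReal_pos.2 ht).ne'
  have h1 : volume {x | t < |f x|} ^ (1 / p) ≤ C / ENNReal.ofReal t := by
    rw [ENNReal.le_div_iff_mul_le (Or.inl ht0) (Or.inl ENNReal.ofReal_ne_top), mul_comm]
    exact h t ht
  have h2 := ENNReal.rpow_le_rpow h1 hp.le
  rw [← ENNReal.rpow_mul, one_div_mul_cancel hp.ne', ENNReal.rpow_one] at h2
  refine h2.trans (le_of_eq ?_)
  rw [div_eq_mul_inv, ENNReal.mul_rpow_of_nonneg _ _ hp.le, ENNReal.inv_rpow, ← ENNReal.rpow_neg,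
    ENNReal.ofReal_rpow_of_pos ht]

theorem lintegral_min_one_rpow_ne_top (hp : 0 < p) (hf : MemWeakLp p f) {q : ℝ} (hq : p < q) :
    ∫⁻ x, ENNReal.ofReal (min |f x| 1) ^ q ≠ ∞ := by
  obtain ⟨D, hD, h⟩ := hf.exists_measure_le hp
  have hq0 := hp.trans hq
  have hm : Measurable fun x => min |f x| 1 := hf.1.norm.min measurable_const
  have hnn : ∀ x, 0 ≤ min |f x| 1 := fun x => by positivity
  simp_rw [fun x => ENNReal.ofReal_rpow_of_nonneg (hnn x) hq0.le]
  rw [lintegral_rpow_eq_lintegral_meas_lt_mul _ (ae_of_all _ hnn) hm.aemeasurable hq0]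
  refine ENNReal.mul_ne_top ENNReal.ofReal_ne_top (ne_top_of_le_ne_top ?_
    (setLIntegral_mono' (g := (Ioo 0 1).indicator fun t => D * ENNReal.ofReal (t ^ ((q - p) - 1)))
      measurableSet_Ioi fun t ht => ?_))
  · rw [setLIntegral_indicator measurableSet_Ioo, inter_eq_left.2 Ioo_subset_Ioi_self,
      lintegral_const_mul' _ _ hD, lintegral_Ioo_rpow_sub_one (sub_pos.2 hq) zero_le_one]
    finiteness
  · rw [mem_Ioi] at ht
    by_cases ht1 : t < 1
    · rw [indicator_of_mem (show t ∈ Ioo 0 1 from ⟨ht, ht1⟩)]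
      calc volume {x | t < min |f x| 1} * ENNReal.ofReal (t ^ (q - 1))
          ≤ D * ENNReal.ofReal (t ^ (-p)) * ENNReal.ofReal (t ^ (q - 1)) := by
            gcongr
            have hsub : {x | t < min |f x| 1} ⊆ {x | t < |f x|} := fun x hx => by
              rw [mem_ofPred_eq, lt_min_iff] at hx
              exact hx.1
            exact (measure_mono hsub).trans (h t ht)
        _ = _ := by
            rw [mul_assoc, ← ENNReal.ofReal_mul (by positivity), ← Real.rpow_add ht]
            congr 3; ring
    · have : {x | t < min |f x| 1} = ∅ :=
        eq_empty_of_forall_notMem fun x hx => ht1 (lt_min_iff.1 hx).2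
      rw [this, measure_empty, zero_mul]
      exact zero_le

theorem lintegral_indicator_rpow_ne_top (hp : 0 < p) (hf : MemWeakLp p f) {s : ℝ} (hs : 0 < s)
    (hsp : s < p) :
    ∫⁻ x, {x | 1 < |f x|}.indicator (fun x => ENNReal.ofReal |f x|) x ^ s ≠ ∞ := by
  obtain ⟨D, hD, h⟩ := hf.exists_measure_le hp
  have hm : Measurable ({x | 1 < |f x|}.indicator fun x => |f x|) :=
    hf.1.norm.indicator (measurableSet_lt measurable_const hf.1.norm)
  have hnn : ∀ x, 0 ≤ {x | 1 < |f x|}.indicator (fun x => |f x|) x := fun x =>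
    indicator_nonneg (fun _ _ => abs_nonneg _) x
  have hF : ∀ x, {x | 1 < |f x|}.indicator (fun x => ENNReal.ofReal |f x|) x ^ s =
      ENNReal.ofReal ({x | 1 < |f x|}.indicator (fun x => |f x|) x ^ s) := fun x => by
    rw [← ENNReal.ofReal_rpow_of_nonneg (hnn x) hs.le]
    by_cases hx : 1 < |f x| <;> simp [hx]
  have hlt : ∀ t x, 0 < t → t < {x | 1 < |f x|}.indicator (fun x => |f x|) x →
      1 < |f x| ∧ t < |f x| := fun t x ht hx => by
    by_cases h1 : 1 < |f x|
    · exact ⟨h1, by simpa [h1] using hx⟩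
    · simp [h1] at hx; linarith
  simp_rw [hF]
  rw [lintegral_rpow_eq_lintegral_meas_lt_mul _ (ae_of_all _ hnn) hm.aemeasurable hs]
  refine ENNReal.mul_ne_top ENNReal.ofReal_ne_top ?_
  rw [← Ioc_union_Ioi_eq_Ioi zero_le_one,
    lintegral_union measurableSet_Ioi (Ioc_disjoint_Ioi le_rfl)]
  refine ENNReal.add_ne_top.2 ⟨?_, ?_⟩
  · refine ne_top_of_le_ne_top ?_ (setLIntegral_mono'
      (g := fun t => D * ENNReal.ofReal (t ^ (s - 1))) measurableSet_Ioc fun t ht => ?_)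
    · rw [lintegral_const_mul' _ _ hD, setLIntegral_congr (Ioo_ae_eq_Ioc (a := (0 : ℝ))).symm,
        lintegral_Ioo_rpow_sub_one hs zero_le_one]
      finiteness
    · gcongr
      refine (measure_mono fun x hx => (hlt t x ht.1 hx).1).trans ((h 1 one_pos).trans ?_)
      simp
  · refine ne_top_of_le_ne_top ?_ (setLIntegral_mono'
      (g := fun t => D * ENNReal.ofReal (t ^ (s - p - 1))) measurableSet_Ioi fun t ht => ?_)
    · rw [lintegral_const_mul' _ _ hD]
      exact ENNReal.mul_ne_top hD
        (integrableOn_Ioi_rpow_of_lt (by linarith) one_pos).lintegral_lt_top.ne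
    · have ht0 : 0 < t := one_pos.trans ht
      calc _ ≤ D * ENNReal.ofReal (t ^ (-p)) * ENNReal.ofReal (t ^ (s - 1)) := by
            gcongr
            exact (measure_mono fun x hx => (hlt t x ht0 hx).2).trans (h t ht0)
        _ = _ := by
            rw [mul_assoc, ← ENNReal.ofReal_mul (by positivity), ← Real.rpow_add ht0]
            congr 3; ring

/-- Weak Lebesgue functions lie in weighted Lebesgue spaces with Muckenhoupt weights. -/
theorem exists_memLw (hp : 1 < p) (hf : MemWeakLp p f) {p₀ : ℝ} (hp₀ : 1 < p₀) :
    ∃ w, MemA univ p₀ w ∧ MemLw univ p₀ w f := by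
  have hp' : 0 < p := one_pos.trans hp
  have hp₀' : 0 < p₀ := one_pos.trans hp₀
  set s := (1 + p) / 2 with hs
  have hs1 : 1 < s := by linarith
  let F : (Fin n → ℝ) → ℝ≥0∞ := {x | 1 < |f x|}.indicator fun x => ENNReal.ofReal |f x|
  let G : (Fin n → ℝ) → ℝ≥0∞ := fun x => ENNReal.ofReal (min |f x| 1)
  have hFm : Measurable F := hf.1.norm.ennreal_ofReal.indicator
    (measurableSet_lt measurable_const hf.1.norm)
  have hGm : Measurable G := (hf.1.norm.min measurable_const).ennreal_ofReal
  have hFs : ∫⁻ x, F x ^ s ≠ ∞ :=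
    hf.lintegral_indicator_rpow_ne_top hp' (by linarith) (by linarith)
  have hpair := MuckenhouptPair.one (n := n) (Real.HolderConjugate.conjExponent hs1)
  obtain ⟨u, hu, hFu, hus⟩ := hpair.exists_isAOne_majorant hFm (by simpa using hFs)
  have hut := hpair.ae_ne_top_of_lintegral_ne_top hu.measurable hus
  have hQ : 1 < p + 1 := by linarith
  have hQr := Real.HolderConjugate.conjExponent hQ
  obtain ⟨v, hv, hv1, hvr⟩ := exists_isAOne_le_one (n := n) hQr.symm.lt
  have hW1 : ∀ x, v x * (1 + u x) ^ (1 - p₀) ≤ 1 := fun x => mul_le_one' (hv1 x)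
    (ENNReal.rpow_le_one_of_one_le_of_neg le_self_add (by linarith))
  have hGv : ∫⁻ x, G x ^ p₀ * v x ≠ ∞ := by
    refine ne_top_of_le_ne_top ?_ (ENNReal.lintegral_mul_le_Lp_mul_Lq volume hQr
      (hGm.pow_const p₀).aemeasurable hv.measurable.aemeasurable)
    have h1 : ∫⁻ x, (G x ^ p₀) ^ (p + 1) ≠ ∞ := by
      simp_rw [← ENNReal.rpow_mul]
      exact hf.lintegral_min_one_rpow_ne_top hp' (by nlinarith)
    exact ENNReal.mul_ne_top
      (ENNReal.rpow_ne_top_of_nonneg (by positivity) h1)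
      (ENNReal.rpow_ne_top_of_nonneg (one_div_nonneg.2 hQr.symm.nonneg) hvr)
  refine ⟨_, Or.inr ⟨hp₀, hv.memApGT1_mul_rpow hu.one_add hv1 (fun x => le_self_add)
    (hut.mono fun x hx => by finiteness) hp₀⟩, hf.1, ?_⟩
  rw [Measure.restrict_univ]
  refine lt_top_iff_ne_top.2 (ne_top_of_le_ne_top (ENNReal.add_ne_top.2 ⟨hFs, hGv⟩) ?_)
  rw [← lintegral_add_left (hFm.pow_const s)]
  refine lintegral_mono fun x => ?_
  rw [ENNReal.ofReal_toReal (ne_top_of_le_ne_top ENNReal.one_ne_top (hW1 x))]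
  rcases lt_or_ge 1 |f x| with hx | hx
  · have hFx : F x = ENNReal.ofReal |f x| := indicator_of_mem (s := {x | 1 < |f x|}) hx _
    have hF1 : 1 ≤ F x := by rw [hFx, ENNReal.one_le_ofReal]; exact hx.le
    have hFt : F x ≠ ∞ := by rw [hFx]; exact ENNReal.ofReal_ne_top
    refine le_add_right ?_
    calc ENNReal.ofReal |f x| ^ p₀ * (v x * (1 + u x) ^ (1 - p₀))
        ≤ F x ^ p₀ * (1 * F x ^ (1 - p₀)) := by
          rw [hFx]
          refine mul_le_mul' le_rfl (mul_le_mul' (hv1 x) ?_)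
          rw [← neg_sub p₀ 1, ENNReal.rpow_neg, ENNReal.rpow_neg, ENNReal.inv_le_inv, ← hFx]
          exact ENNReal.rpow_le_rpow ((hFu x).trans le_add_self) (by linarith)
      _ = F x ^ (1 : ℝ) := by
          rw [one_mul, ← ENNReal.rpow_add _ _ (one_pos.trans_le hF1).ne' hFt]
          congr 1; ring
      _ ≤ F x ^ s := ENNReal.rpow_le_rpow_of_exponent_le hF1 hs1.le
  · refine le_add_left (mul_le_mul' (le_of_eq ?_) ?_)
    · simp only [G, min_eq_left hx]
    · exact mul_le_of_le_one_right' (ENNReal.rpow_le_one_of_one_le_of_neg le_self_add (by linarith))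

end MemWeakLp

/-- A Muckenhoupt weighted Lebesgue space contains functions in no weak Lebesgue space. -/
theorem exists_memLw_forall_not_memWeakLp (hn : 0 < n) {p₀ : ℝ} (hp₀ : 1 < p₀) :
    ∃ f : (Fin n → ℝ) → ℝ, (∃ w, MemA univ p₀ w ∧ MemLw univ p₀ w f) ∧
      ∀ p, 0 < p → ¬ MemWeakLp p f := by
  have : Nonempty (Fin n) := ⟨⟨0, hn⟩⟩
  obtain ⟨v, hv, hv1, hv2⟩ := exists_isAOne_le_one (n := n) one_lt_two
  let B : ℕ → Set (Fin n → ℝ) := fun j => ball (fun _ => 3 * j) 1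
  have hBm : ∀ j, MeasurableSet (B j) := fun j => measurableSet_ball
  have hBd : Pairwise (Function.onFun Disjoint B) := fun i j hij => by
    refine ball_disjoint_ball ?_
    rw [dist_pi_const, Real.dist_eq, ← mul_sub, abs_mul, abs_of_pos three_pos]
    have : (1 : ℝ) ≤ |(i : ℝ) - j| := by
      exact_mod_cast Int.one_le_abs (sub_ne_zero.2 (Nat.cast_injective.ne hij) : (i : ℤ) - j ≠ 0)
    linarith
  have hB : ∀ j, volume (B j) = volume (ball (0 : Fin n → ℝ) 1) := fun j =>
    Measure.addHaar_ball_center _ _ _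
  have hsum : ∑' j, ∫⁻ x in B j, v x ^ (2 : ℝ) ≠ ∞ := by
    rw [← lintegral_iUnion hBm hBd]
    exact ne_top_of_le_ne_top hv2 (setLIntegral_le_lintegral _ _)
  have hle : ∀ j, ∫⁻ x in B j, v x ≤ (∫⁻ x in B j, v x ^ (2 : ℝ)) ^ (1 / 2 : ℝ) *
      volume (ball (0 : Fin n → ℝ) 1) ^ (1 / 2 : ℝ) := fun j => by
    have := ENNReal.lintegral_mul_le_Lp_mul_Lq (volume.restrict (B j)) Real.HolderConjugate.two_two
      hv.measurable.aemeasurable (g := fun _ => 1) aemeasurable_const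
    simpa [hB] using this
  have hlim : Tendsto (fun j => ∫⁻ x in B j, v x) atTop (𝓝 0) := by
    refine tendsto_of_tendsto_of_tendsto_of_le_of_le tendsto_const_nhds ?_ (fun _ => zero_le) hle
    have h1 := (ENNReal.continuous_rpow_const (y := 1 / 2)).continuousAt.tendsto.comp
      (ENNReal.tendsto_atTop_zero_of_tsum_ne_top hsum)
    have h2 := ENNReal.Tendsto.mul_const (b := volume (ball (0 : Fin n → ℝ) 1) ^ (1 / 2 : ℝ)) h1
      (Or.inr (by finiteness))
    simpa [Function.comp_def] using h2
  obtain ⟨φ, hφ, hφv⟩ := extraction_forall_of_eventually fun k =>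
    hlim.eventually_le_const (u := (2⁻¹ : ℝ≥0∞) ^ k)
    (ENNReal.pow_pos (by simp) k)
  have hφd : Pairwise (Function.onFun Disjoint fun k => B (φ k)) := fun i j hij =>
    hBd (hφ.injective.ne hij)
  let E := ⋃ k, B (φ k)
  have hEm : MeasurableSet E := MeasurableSet.iUnion fun k => hBm _
  have hE : volume E = ∞ := by
    rw [measure_iUnion hφd fun k => hBm _]
    simp_rw [hB]
    exact ENNReal.tsum_const_eq_top_of_ne_zero (measure_ball_pos _ _ one_pos).ne'
  have hEv : ∫⁻ x in E, v x ≠ ∞ := by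
    rw [lintegral_iUnion (fun k => hBm _) hφd]
    refine ne_top_of_le_ne_top ?_ (ENNReal.tsum_le_tsum hφv)
    rw [ENNReal.tsum_geometric, ENNReal.one_sub_inv_two, inv_inv]
    finiteness
  refine ⟨E.indicator 1, ⟨_, Or.inr ⟨hp₀, hv.memApGT1_mul_rpow .one hv1 (fun _ => le_rfl)
    (by simp) hp₀⟩, measurable_one.indicator hEm, ?_⟩, fun p hp h => ?_⟩
  · rw [Measure.restrict_univ]
    refine lt_top_iff_ne_top.2 (ne_top_of_le_ne_top hEv ?_)
    rw [← lintegral_indicator hEm]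
    refine lintegral_mono fun x => ?_
    have := ne_top_of_le_ne_top ENNReal.one_ne_top (hv1 x)
    by_cases hx : x ∈ E <;> simp [hx, this, one_pos.trans hp₀]
  · obtain ⟨D, hD, h⟩ := h.exists_measure_le hp
    have h1 : volume E ≤ D * ENNReal.ofReal ((1 / 2) ^ (-p)) := by
      refine (measure_mono fun x hx => ?_).trans (h (1 / 2) (by norm_num))
      rw [mem_ofPred_eq, indicator_of_mem hx]
      norm_num
    rw [hE, top_le_iff] at h1
    exact ENNReal.mul_ne_top hD ENNReal.ofReal_ne_top h1

end WeakLebesgue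

section Majorant

variable {n : ℕ}

/-- Functions in Muckenhoupt weighted Lebesgue spaces have `A₁` majorants. -/
theorem MemLw.hasApMajorant {p : ℝ} (hp : 1 < p) {w f : (Fin n → ℝ) → ℝ} (hw : MemA univ p w)
    (hf : MemLw univ p w f) : HasApMajorant univ 1 f := by
  obtain ⟨rfl, -⟩ | ⟨-, hw⟩ := hw
  · exact absurd hp (lt_irrefl _)
  obtain ⟨w', σ, h, hww⟩ := hw.exists_muckenhouptPair hp
  obtain ⟨hfm, hfin⟩ := hf
  rw [Measure.restrict_univ] at hfin
  have hfin' : ∫⁻ x, ENNReal.ofReal |f x| ^ p * w' x ≠ ∞ := by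
    refine ne_of_eq_of_ne (lintegral_congr_ae ?_) hfin.ne
    filter_upwards [hww] with x hx
    rw [hx]
  obtain ⟨u, hu, hfu, hui⟩ := h.exists_isAOne_majorant hfm.norm.ennreal_ofReal hfin'
  have hut := h.ae_ne_top_of_lintegral_ne_top hu.measurable hui
  refine ⟨hfm, _, Or.inl ⟨rfl, hu.memA1_toReal hut⟩, ?_⟩
  rw [Measure.restrict_univ]
  filter_upwards [hut] with x hx
  exact (ENNReal.ofReal_le_iff_le_toReal hx).1 (hfu x)

theorem hasApMajorant_one : HasApMajorant univ 1 fun _ : Fin n → ℝ => (1 : ℝ) :=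
  ⟨measurable_const, _, Or.inl ⟨rfl, IsAOne.one.memA1_toReal (by simp)⟩, by simp⟩

theorem MuckenhouptPair.lintegral_eq_top (hn : 0 < n) {p q : ℝ} {w σ : (Fin n → ℝ) → ℝ≥0∞}
    (h : MuckenhouptPair p q w σ) : ∫⁻ x, w x = ∞ := by
  have : Nonempty (Fin n) := ⟨⟨0, hn⟩⟩
  by_contra hfin
  obtain ⟨K, hK, hb⟩ := h.exists_measure_mul_le
  have hp := h.holder.pos
  set K' := K * (4 ^ n) ^ p with hK'
  have hKt : K' ≠ ∞ := by finiteness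
  have hle : ∀ m : ℕ, ∫⁻ x in ball 0 1, w x ≤ K' * ∫⁻ x in (ball 0 (m : ℝ))ᶜ, w x := by
    intro m
    set r : ℝ := m + 1 with hr
    have hr1 : 1 ≤ r := by simp [hr]
    have hr0 : 0 < r := one_pos.trans_le hr1
    have hd : dist (fun _ => 3 * r / 2 : Fin n → ℝ) 0 = 3 * r / 2 := by
      rw [show (0 : Fin n → ℝ) = fun _ => 0 from rfl, dist_pi_const, Real.dist_0_eq_abs,
        abs_of_pos (by positivity)]
    have hE : ball (fun _ => 3 * r / 2 : Fin n → ℝ) (r / 2) ⊆ ball 0 (2 * r) :=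
      ball_subset_ball' (by rw [hd]; linarith)
    have hE' : ball (fun _ => 3 * r / 2 : Fin n → ℝ) (r / 2) ⊆ (ball 0 (m : ℝ))ᶜ := by
      rw [subset_compl_iff_disjoint_right]
      refine ball_disjoint_ball ?_
      rw [hd]; linarith
    have hvol : volume (ball (0 : Fin n → ℝ) (2 * r)) =
        4 ^ n * volume (ball (fun _ => 3 * r / 2 : Fin n → ℝ) (r / 2)) := by
      rw [Measure.addHaar_ball_center volume (fun _ => 3 * r / 2 : Fin n → ℝ),
        show 2 * r = 4 * (r / 2) by ring, Measure.addHaar_ball_mul_of_pos _ _ four_pos,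
        Module.finrank_fin_fun, ENNReal.ofReal_pow four_pos.le, ENNReal.ofReal_ofNat,
        Measure.addHaar_ball_center]
    have h1 := hb 0 (2 * r) (by positivity) _ hE
    rw [hvol, ENNReal.mul_rpow_of_nonneg _ _ hp.le, ← mul_assoc, ← hK', mul_right_comm,
      mul_comm (_ ^ p)] at h1
    have h0 : volume (ball (fun _ => 3 * r / 2 : Fin n → ℝ) (r / 2)) ^ p ≠ 0 := by
      rw [Ne, ENNReal.rpow_eq_zero_iff_of_pos hp]
      exact (measure_ball_pos _ _ (by positivity)).ne'
    have ht : volume (ball (fun _ => 3 * r / 2 : Fin n → ℝ) (r / 2)) ^ p ≠ ∞ :=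
      ENNReal.rpow_ne_top_of_nonneg hp.le measure_ball_lt_top.ne
    rw [ENNReal.mul_le_mul_iff_left h0 ht] at h1
    calc ∫⁻ x in ball 0 1, w x ≤ ∫⁻ x in ball 0 (2 * r), w x :=
          lintegral_mono_set (ball_subset_ball (by linarith))
      _ ≤ _ := h1
      _ ≤ _ := by gcongr
  have hlim : Tendsto (fun m : ℕ => ∫⁻ x in (ball (0 : Fin n → ℝ) (m : ℝ))ᶜ, w x) atTop (𝓝 0) := by
    have h1 := tendsto_measure_iInter_atTop (μ := volume.withDensity w)
      (s := fun m : ℕ => (ball (0 : Fin n → ℝ) (m : ℝ))ᶜ)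
      (fun m => measurableSet_ball.compl.nullMeasurableSet)
      (fun i j hij => compl_subset_compl.2 (ball_subset_ball (by exact_mod_cast hij)))
      ⟨0, ne_top_of_le_ne_top (by rwa [withDensity_apply _ .univ, Measure.restrict_univ])
        (measure_mono (subset_univ _))⟩
    rw [← compl_iUnion, iUnion_ball_nat, compl_univ, measure_empty] at h1
    refine h1.congr fun m => ?_
    rw [Function.comp_apply, withDensity_apply _ measurableSet_ball.compl]
  have hlim' := ENNReal.Tendsto.const_mul hlim (Or.inr hKt)
  rw [mul_zero] at hlim'
  exact h.lintegral_ball_ne_zero 0 one_pos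
    (nonpos_iff_eq_zero.1 (ge_of_tendsto' hlim' hle))

theorem not_memLw_one (hn : 0 < n) {p : ℝ} (hp : 1 < p) {w : (Fin n → ℝ) → ℝ}
    (hw : MemA univ p w) : ¬ MemLw univ p w fun _ => 1 := by
  rintro ⟨-, hfin⟩
  obtain ⟨rfl, -⟩ | ⟨-, hw⟩ := hw
  · exact absurd hp (lt_irrefl _)
  obtain ⟨w', σ, h, hww⟩ := hw.exists_muckenhouptPair hp
  rw [Measure.restrict_univ] at hfin
  simp only [abs_one, ENNReal.ofReal_one, ENNReal.one_rpow, one_mul] at hfin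
  rw [← lintegral_congr_ae hww, h.lintegral_eq_top hn] at hfin
  exact lt_irrefl _ hfin

end Majorant

theorem stmt4 (n : ℕ) (hn : 0 < n) (p₀ : ℝ) (hp₀ : 1 < p₀) :
    {f : (Fin n → ℝ) → ℝ | ∃ p, 1 < p ∧ MemWeakLp p f} ⊂
      {f | ∃ w, MemA Set.univ p₀ w ∧ MemLw Set.univ p₀ w f} ∧
    {f : (Fin n → ℝ) → ℝ | ∃ w, MemA Set.univ p₀ w ∧ MemLw Set.univ p₀ w f} ⊂
      {f | HasApMajorant Set.univ 1 f} := by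
  refine ⟨⟨fun f ⟨p, hp, hf⟩ => hf.exists_memLw hp hp₀, fun hsub => ?_⟩,
    ⟨fun f ⟨w, hw, hf⟩ => hf.hasApMajorant hp₀ hw, fun hsub => ?_⟩⟩
  · obtain ⟨f, hf, hf'⟩ := exists_memLw_forall_not_memWeakLp hn hp₀
    obtain ⟨p, hp, hfp⟩ := hsub hf
    exact hf' p (one_pos.trans hp) hfp
  · obtain ⟨w, hw, hf⟩ := hsub hasApMajorant_one
    exact not_memLw_one hn hp₀ hw hf
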